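/- Suppose uC_φ is invertible on the Bloch space, φ is a hyperbolic automorphism with attractive fixed point a and repulsive fixed point b on ∂D, u ∈ A(D), and |u(a)| = |u(b)|. Then the spectrum of uC_φ on the Bloch space is exactly the circle {λ : |λ| = |u(a)|}. -/

import Mathlib

open Complex Metric Set Filter MeasureTheory Finset

noncomputable section

/-- The open unit disc in ℂ. -/
def D1 : Set ℂ := Metric.ball 0 1

/-- Analytic (holomorphic) on the open unit disc. -/
def AnalyticOnD (f : ℂ → ℂ) : Prop := DifferentiableOn ℂ f D1

/-- Bloch seminorm. -/
def blochSemi (f : ℂ → ℂ) : ℝ := ⨆ z : D1, (1 - ‖(z : ℂ)‖ ^ 2) * ‖deriv f (z : ℂ)‖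

/-- Bloch norm. -/
def blochNorm (f : ℂ → ℂ) : ℝ := ‖f 0‖ + blochSemi f

/-- Membership in the Bloch space. -/
def InBloch (f : ℂ → ℂ) : Prop :=
  AnalyticOnD f ∧ ∃ C, ∀ z ∈ D1, (1 - ‖z‖ ^ 2) * ‖deriv f z‖ ≤ C

/-- Sup norm over the unit disc. -/
def supNormD (f : ℂ → ℂ) : ℝ := ⨆ z : D1, ‖f (z : ℂ)‖

/-- Weighted composition operator uC_φ. -/
def wco (u φ : ℂ → ℂ) (f : ℂ → ℂ) : ℂ → ℂ := fun z => u z * f (φ z)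

/-- Multiplication operator M_u. -/
def mult (u : ℂ → ℂ) (f : ℂ → ℂ) : ℂ → ℂ := fun z => u z * f z

/-- The weight u_{(n)} = ∏_{j=0}^{n-1} u ∘ φ_j. -/
def wprod (u φ : ℂ → ℂ) (n : ℕ) : ℂ → ℂ := fun z => ∏ j ∈ Finset.range n, u (φ^[j] z)

/-- Boundedness of an operator on the Bloch space. -/
def BddOnBloch (T : (ℂ → ℂ) → (ℂ → ℂ)) : Prop :=
  ∃ C, ∀ f, InBloch f → InBloch (T f) ∧ blochNorm (T f) ≤ C * blochNorm f

/-- Operator norm on the Bloch space. -/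
def opNormB (T : (ℂ → ℂ) → (ℂ → ℂ)) : ℝ :=
  sInf {C : ℝ | 0 ≤ C ∧ ∀ f, InBloch f → blochNorm (T f) ≤ C * blochNorm f}

/-- Invertibility of an operator on the Bloch space (bounded two-sided inverse). -/
def InvertibleOnBloch (T : (ℂ → ℂ) → (ℂ → ℂ)) : Prop :=
  BddOnBloch T ∧ ∃ S, BddOnBloch S ∧
    ∀ f, InBloch f → Set.EqOn (S (T f)) f D1 ∧ Set.EqOn (T (S f)) f D1

/-- Spectrum of an operator acting on the Bloch space. -/
def blochSpectrum (T : (ℂ → ℂ) → (ℂ → ℂ)) : Set ℂ :=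
  {lam | ¬ InvertibleOnBloch (fun f z => lam * f z - T f z)}

/-- Automorphism of the unit disc (Möbius form). -/
def IsDiscAuto (φ : ℂ → ℂ) : Prop :=
  ∃ lam a : ℂ, ‖lam‖ = 1 ∧ a ∈ D1 ∧ ∀ z, φ z = lam * (a - z) / (1 - (starRingEnd ℂ) a * z)

/-- Hyperbolic distance on the unit disc. -/
def hypDist (z w : ℂ) : ℝ :=
  (1 / 2) * Real.log ((1 + ‖(z - w) / (1 - (starRingEnd ℂ) z * w)‖) /
    (1 - ‖(z - w) / (1 - (starRingEnd ℂ) z * w)‖))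

/-- The disc algebra A(𝔻). -/
def InDiscAlgebra (u : ℂ → ℂ) : Prop :=
  ContinuousOn u (Metric.closedBall 0 1) ∧ AnalyticOnD u

/-- u is bounded away from zero on the unit disc. -/
def BoundedAwayFromZero (u : ℂ → ℂ) : Prop := ∃ δ > 0, ∀ z ∈ D1, δ ≤ ‖u z‖

/-- Parabolic automorphism with unique fixed point a on the unit circle (φ'(a)=1). -/
def IsParabolicAuto (φ : ℂ → ℂ) (a : ℂ) : Prop :=
  IsDiscAuto φ ∧ ‖a‖ = 1 ∧ φ a = a ∧ deriv φ a = 1 ∧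
    ∀ w, ‖w‖ ≤ 1 → φ w = w → w = a

/-- Hyperbolic automorphism with attractive fixed point a and repulsive fixed point b. -/
def IsHyperbolicAuto (φ : ℂ → ℂ) (a b : ℂ) : Prop :=
  IsDiscAuto φ ∧ ‖a‖ = 1 ∧ ‖b‖ = 1 ∧ a ≠ b ∧ φ a = a ∧ φ b = b ∧
    ∃ μ : ℝ, 0 < μ ∧ μ < 1 ∧ deriv φ a = (μ : ℂ)

/-- Square of the Dirichlet norm (normalized area measure on 𝔻). -/
def dirichletNormSq (f : ℂ → ℂ) : ℝ :=
  ‖f 0‖ ^ 2 + (1 / Real.pi) * ∫ z in D1, ‖deriv f z‖ ^ 2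

/-- Dirichlet norm. -/
def dirichletNorm (f : ℂ → ℂ) : ℝ := Real.sqrt (dirichletNormSq f)

/-- Membership in the Dirichlet space. -/
def InDirichlet (f : ℂ → ℂ) : Prop :=
  AnalyticOnD f ∧ MeasureTheory.IntegrableOn (fun z => ‖deriv f z‖ ^ 2) D1

/-- Boundedness of an operator on the Dirichlet space. -/
def BddOnDirichlet (T : (ℂ → ℂ) → (ℂ → ℂ)) : Prop :=
  ∃ C, ∀ f, InDirichlet f → InDirichlet (T f) ∧ dirichletNorm (T f) ≤ C * dirichletNorm f

/-- Operator norm on the Dirichlet space. -/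
def opNormDir (T : (ℂ → ℂ) → (ℂ → ℂ)) : ℝ :=
  sInf {C : ℝ | 0 ≤ C ∧ ∀ f, InDirichlet f → dirichletNorm (T f) ≤ C * dirichletNorm f}

/-- Invertibility of an operator on the Dirichlet space. -/
def InvertibleOnDirichlet (T : (ℂ → ℂ) → (ℂ → ℂ)) : Prop :=
  BddOnDirichlet T ∧ ∃ S, BddOnDirichlet S ∧
    ∀ f, InDirichlet f → Set.EqOn (S (T f)) f D1 ∧ Set.EqOn (T (S f)) f D1

/-- Spectrum of an operator on the Dirichlet space. -/
def dirichletSpectrum (T : (ℂ → ℂ) → (ℂ → ℂ)) : Set ℂ :=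
  {lam | ¬ InvertibleOnDirichlet (fun f z => lam * f z - T f z)}

/-- Operator norm of M_{u'} : B → H^∞_{v₁}. -/
def opNormBtoHv1 (u : ℂ → ℂ) : ℝ :=
  sInf {C : ℝ | 0 ≤ C ∧ ∀ f, InBloch f → ∀ z ∈ D1,
    (1 - ‖z‖ ^ 2) * ‖deriv u z * f z‖ ≤ C * blochNorm f}

/-- Operator norm of M_{u'} : 𝒟 → A². -/
def opNormDtoA2 (u : ℂ → ℂ) : ℝ :=
  sInf {C : ℝ | 0 ≤ C ∧ ∀ f, InDirichlet f →
    Real.sqrt ((1 / Real.pi) * ∫ z in D1, ‖deriv u z * f z‖ ^ 2) ≤ C * dirichletNorm f}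

/-- The logarithmic weight log(e/(1-|z|²)). -/
def logWeight (z : ℂ) : ℝ := Real.log (Real.exp 1 / (1 - ‖z‖ ^ 2))

/-- Characterization of multipliers of the Bloch space: u ∈ H^∞ and the log condition. -/
def MultBChar (u : ℂ → ℂ) : Prop :=
  (∃ M, ∀ z ∈ D1, ‖u z‖ ≤ M) ∧
  (∃ M, ∀ z ∈ D1, (1 - ‖z‖ ^ 2) * ‖deriv u z‖ * logWeight z ≤ M)

/-! ### Basic facts on the Bloch space -/

theorem isOpen_D1 : IsOpen D1 := Metric.isOpen_ball

theorem mem_D1 {z : ℂ} : z ∈ D1 ↔ ‖z‖ < 1 := by simp [D1]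

theorem zero_mem_D1 : (0 : ℂ) ∈ D1 := by simp [mem_D1]

instance instNonemptyD1 : Nonempty D1 := ⟨⟨0, zero_mem_D1⟩⟩

theorem one_sub_sq_pos {z : ℂ} (hz : z ∈ D1) : 0 < 1 - ‖z‖ ^ 2 := by
  have := mem_D1.1 hz
  nlinarith [norm_nonneg z]

/-- logarithmic weight -/
def ell (z : ℂ) : ℝ := 1 - Real.log (1 - ‖z‖ ^ 2)

theorem one_le_ell {z : ℂ} (hz : z ∈ D1) : 1 ≤ ell z := by
  have h1 := one_sub_sq_pos hz
  have : Real.log (1 - ‖z‖ ^ 2) ≤ 0 := Real.log_nonpos h1.le (by nlinarith [norm_nonneg z])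
  unfold ell; linarith

theorem semi_bound {f : ℂ → ℂ} (hf : InBloch f) {z : ℂ} (hz : z ∈ D1) :
    (1 - ‖z‖ ^ 2) * ‖deriv f z‖ ≤ blochSemi f := by
  obtain ⟨_, C, hC⟩ := hf
  have : BddAbove (Set.range fun z : D1 => (1 - ‖(z : ℂ)‖ ^ 2) * ‖deriv f (z : ℂ)‖) := by
    refine ⟨C, ?_⟩
    rintro _ ⟨w, rfl⟩
    exact hC w w.2
  exact le_ciSup this ⟨z, hz⟩

theorem semi_le {f : ℂ → ℂ} {C : ℝ} (h : ∀ z ∈ D1, (1 - ‖z‖ ^ 2) * ‖deriv f z‖ ≤ C) :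
    blochSemi f ≤ C := ciSup_le fun z => h z z.2

theorem semi_nonneg (f : ℂ → ℂ) : 0 ≤ blochSemi f :=
  Real.iSup_nonneg fun z => mul_nonneg (one_sub_sq_pos z.2).le (norm_nonneg _)

theorem blochNorm_nonneg (f : ℂ → ℂ) : 0 ≤ blochNorm f :=
  add_nonneg (norm_nonneg _) (semi_nonneg f)

theorem deriv_eqOnD {f g : ℂ → ℂ} (h : Set.EqOn f g D1) {z : ℂ} (hz : z ∈ D1) :
    deriv f z = deriv g z :=
  Filter.EventuallyEq.deriv_eq (h.eventuallyEq_of_mem (isOpen_D1.mem_nhds hz))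

theorem InBloch.congr {f g : ℂ → ℂ} (hf : InBloch f) (h : Set.EqOn g f D1) : InBloch g := by
  obtain ⟨h1, C, hC⟩ := hf
  refine ⟨h1.congr h, C, fun z hz => ?_⟩
  rw [deriv_eqOnD h hz]; exact hC z hz

theorem blochNorm_congr {f g : ℂ → ℂ} (h : Set.EqOn g f D1) : blochNorm g = blochNorm f := by
  unfold blochNorm blochSemi
  rw [h zero_mem_D1]
  congr 2
  funext z
  rw [deriv_eqOnD h z.2]

theorem InBloch.diffAt {f : ℂ → ℂ} (hf : InBloch f) {z : ℂ} (hz : z ∈ D1) :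
    DifferentiableAt ℂ f z := hf.1.differentiableAt (isOpen_D1.mem_nhds hz)

theorem lin_bloch {f g : ℂ → ℂ} (hf : InBloch f) (hg : InBloch g) (c d : ℂ) :
    InBloch (fun z => c * f z - d * g z) ∧
    blochNorm (fun z => c * f z - d * g z) ≤ ‖c‖ * blochNorm f + ‖d‖ * blochNorm g := by
  have key : ∀ z ∈ D1, (1 - ‖z‖ ^ 2) * ‖deriv (fun z => c * f z - d * g z) z‖ ≤
      ‖c‖ * blochSemi f + ‖d‖ * blochSemi g := by
    intro z hz
    have h0 := (one_sub_sq_pos hz).le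
    have e : deriv (fun z => c * f z - d * g z) z = c * deriv f z - d * deriv g z :=
      (((hf.diffAt hz).hasDerivAt.const_mul c).sub ((hg.diffAt hz).hasDerivAt.const_mul d)).deriv
    rw [e]
    have h1 := semi_bound hf hz
    have h2 := semi_bound hg hz
    have h3 : ‖c * deriv f z - d * deriv g z‖ ≤ ‖c‖ * ‖deriv f z‖ + ‖d‖ * ‖deriv g z‖ := by
      refine (norm_sub_le _ _).trans ?_
      rw [norm_mul, norm_mul]
    calc _ ≤ (1 - ‖z‖ ^ 2) * (‖c‖ * ‖deriv f z‖ + ‖d‖ * ‖deriv g z‖) := by gcongr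
      _ = ‖c‖ * ((1 - ‖z‖ ^ 2) * ‖deriv f z‖) + ‖d‖ * ((1 - ‖z‖ ^ 2) * ‖deriv g z‖) := by ring
      _ ≤ _ := by gcongr
  refine ⟨⟨(hf.1.const_mul c).sub (hg.1.const_mul d), _, key⟩, ?_⟩
  have h4 := semi_le key
  have h5 : ‖c * f 0 - d * g 0‖ ≤ ‖c‖ * ‖f 0‖ + ‖d‖ * ‖g 0‖ := by
    refine (norm_sub_le _ _).trans ?_
    rw [norm_mul, norm_mul]
  unfold blochNorm
  linarith

theorem bloch_growth {f : ℂ → ℂ} (hf : InBloch f) {z : ℂ} (hz : z ∈ D1) :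
    ‖f z‖ ≤ blochNorm f * ell z := by
  have hz1 := mem_D1.1 hz
  set K := blochSemi f with hK
  have hK0 : 0 ≤ K := semi_nonneg f
  have hin : ∀ t : ℝ, t ∈ Set.Icc (0:ℝ) 1 → (t : ℂ) * z ∈ D1 := by
    intro t ht
    rw [mem_D1, norm_mul, Complex.norm_real, Real.norm_eq_abs, abs_of_nonneg ht.1]
    nlinarith [norm_nonneg z, ht.2]
  have hd : ∀ t : ℝ, t ∈ Set.Icc (0:ℝ) 1 →
      HasDerivAt (fun t : ℝ => f ((t : ℂ) * z) - f 0) (deriv f ((t : ℂ) * z) * z) t := by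
    intro t ht
    have h1 := (hf.diffAt (hin t ht)).hasDerivAt
    have h2 : HasDerivAt (fun s : ℂ => s * z) z (t : ℂ) := by
      simpa using (hasDerivAt_id (t : ℂ)).mul_const z
    have h3 : HasDerivAt (fun s : ℂ => f (s * z)) (deriv f ((t : ℂ) * z) * z) (t : ℂ) :=
      HasDerivAt.comp (t : ℂ) h1 h2
    exact (h3.comp_ofReal).sub_const (f 0)
  have hpos : ∀ t : ℝ, t ∈ Set.Icc (0:ℝ) 1 → 0 < 1 - t * ‖z‖ := by
    intro t ht
    nlinarith [norm_nonneg z, ht.2, ht.1]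
  have hB : ∀ t : ℝ, t ∈ Set.Icc (0:ℝ) 1 →
      HasDerivAt (fun t : ℝ => - K * Real.log (1 - t * ‖z‖)) (K * (‖z‖ / (1 - t * ‖z‖))) t := by
    intro t ht
    have h1 : HasDerivAt (fun t : ℝ => 1 - t * ‖z‖) (-‖z‖) t := by
      simpa using ((hasDerivAt_id t).mul_const ‖z‖).const_sub 1
    have h2 := (h1.log (hpos t ht).ne').const_mul (-K)
    have e : K * (‖z‖ / (1 - t * ‖z‖)) = -K * (-‖z‖ / (1 - t * ‖z‖)) := by ring
    rw [e]; exact h2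
  have main := image_norm_le_of_norm_deriv_right_le_deriv_boundary' (a := 0) (b := 1)
    (f := fun t : ℝ => f ((t : ℂ) * z) - f 0)
    (f' := fun t : ℝ => deriv f ((t : ℂ) * z) * z)
    (B := fun t : ℝ => - K * Real.log (1 - t * ‖z‖)) (B' := fun t => K * (‖z‖ / (1 - t * ‖z‖)))
    (fun t ht => (hd t ht).continuousAt.continuousWithinAt)
    (fun t ht => (hd t ⟨ht.1, ht.2.le⟩).hasDerivWithinAt)
    (by simp)
    (fun t ht => (hB t ht).continuousAt.continuousWithinAt)
    (fun t ht => (hB t ⟨ht.1, ht.2.le⟩).hasDerivWithinAt)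
    (by
      intro t ht
      have ht' : t ∈ Set.Icc (0:ℝ) 1 := ⟨ht.1, ht.2.le⟩
      have h1 := semi_bound hf (hin t ht')
      have h2 : ‖(t : ℂ) * z‖ = t * ‖z‖ := by
        rw [norm_mul, Complex.norm_real, Real.norm_eq_abs, abs_of_nonneg ht.1]
      rw [h2] at h1
      have h3 := hpos t ht'
      have h4 : 0 ≤ t * ‖z‖ := mul_nonneg ht.1 (norm_nonneg _)
      have h5 : (1 - t * ‖z‖) * ‖deriv f ((t:ℂ) * z)‖ ≤ K := by
        refine le_trans ?_ h1
        gcongr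
        nlinarith
      rw [norm_mul, ← mul_div_assoc, le_div_iff₀ h3]
      nlinarith [norm_nonneg z])
    (x := 1) (by simp)
  simp only [ofReal_one, one_mul] at main
  have h6 : 1 - ‖z‖ ^ 2 ≤ 2 * (1 - ‖z‖) := by nlinarith [norm_nonneg z]
  have h7 : Real.log (1 - ‖z‖ ^ 2) ≤ Real.log 2 + Real.log (1 - ‖z‖) := by
    rw [← Real.log_mul (by norm_num) (by linarith)]
    exact Real.log_le_log (one_sub_sq_pos hz) h6
  have h8 : Real.log 2 ≤ 1 := by linarith [Real.log_two_lt_d9]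
  have h9 : - Real.log (1 - ‖z‖) ≤ ell z := by unfold ell; linarith
  have h10 : ‖f z‖ ≤ ‖f 0‖ + ‖f z - f 0‖ := by
    have := norm_add_le (f 0) (f z - f 0)
    simpa using this
  have h11 := one_le_ell hz
  unfold blochNorm
  have h12 : K * (- Real.log (1 - ‖z‖)) ≤ K * ell z := by gcongr
  have h13 : ‖f 0‖ * 1 ≤ ‖f 0‖ * ell z := by gcongr
  rw [add_mul, ← hK]
  linarith

theorem bloch_eq_zero {f : ℂ → ℂ} (hf : InBloch f) (h : blochNorm f ≤ 0) {z : ℂ} (hz : z ∈ D1) :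
    f z = 0 := by
  have h1 := bloch_growth hf hz
  have h2 := one_le_ell hz
  have : ‖f z‖ ≤ 0 := by nlinarith
  simpa using this

/-- bounded analytic functions are Bloch -/
theorem bloch_of_bounded {f : ℂ → ℂ} (hf : AnalyticOnD f) {M : ℝ} (hM : ∀ z ∈ D1, ‖f z‖ ≤ M) :
    InBloch f ∧ blochNorm f ≤ 3 * M := by
  have key : ∀ z ∈ D1, (1 - ‖z‖ ^ 2) * ‖deriv f z‖ ≤ 2 * M := by
    intro z hz
    have hz1 := mem_D1.1 hz
    have hM0 : 0 ≤ M := (norm_nonneg _).trans (hM z hz)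
    have hr : ∀ r : ℝ, 0 < r → r < 1 - ‖z‖ → r * ‖deriv f z‖ ≤ M := by
      intro r hr0 hr1
      have hsub : closedBall z r ⊆ D1 := by
        intro w hw
        rw [mem_D1]
        have : ‖w - z‖ ≤ r := by simpa [dist_eq_norm] using hw
        have h2 := norm_add_le (w - z) z
        simp at h2
        linarith
      have := Complex.norm_deriv_le_of_forall_mem_sphere_norm_le (c := z) (R := r) (C := M) (f := f)
        hr0 ((hf.mono hsub).diffContOnCl_ball (Subset.refl _))
        (fun w hw => hM w (hsub (sphere_subset_closedBall hw)))
      rw [le_div_iff₀ hr0] at this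
      linarith
    have h1 : (1 - ‖z‖) * ‖deriv f z‖ ≤ M := by
      by_contra hcon
      push Not at hcon
      have hd : 0 < ‖deriv f z‖ := by
        by_contra h0
        have : ‖deriv f z‖ = 0 := le_antisymm (not_lt.1 h0) (norm_nonneg _)
        rw [this] at hcon; linarith
      have hlt : M / ‖deriv f z‖ < 1 - ‖z‖ := by rwa [div_lt_iff₀ hd]
      obtain ⟨r, h1, h2⟩ := exists_between hlt
      have h3 := hr r (lt_of_le_of_lt (by positivity) h1) h2
      rw [div_lt_iff₀ hd] at h1
      linarith
    nlinarith [norm_nonneg z, norm_nonneg (deriv f z)]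
  refine ⟨⟨hf, _, key⟩, ?_⟩
  have := semi_le key
  have := hM 0 zero_mem_D1
  unfold blochNorm
  linarith

/-! ### Reformulation of invertibility -/

/-- bounded, bounded below and onto -/
def GoodInv (T : (ℂ → ℂ) → (ℂ → ℂ)) : Prop :=
  BddOnBloch T ∧ (∃ C : ℝ, 0 ≤ C ∧ ∀ h, InBloch h → blochNorm h ≤ C * blochNorm (T h)) ∧
    ∀ f, InBloch f → ∃ h, InBloch h ∧ Set.EqOn (T h) f D1

theorem InvertibleOnBloch.goodInv {T : (ℂ → ℂ) → (ℂ → ℂ)} (h : InvertibleOnBloch T) :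
    GoodInv T := by
  obtain ⟨hT, S, ⟨C, hC⟩, hS⟩ := h
  obtain ⟨C', hC'⟩ := id hT
  refine ⟨hT, ⟨|C|, abs_nonneg _, fun h hh => ?_⟩, fun f hf => ⟨S f, (hC f hf).1, (hS f hf).2⟩⟩
  have h1 := (hC _ (hC' h hh).1).2
  rw [blochNorm_congr (hS h hh).1] at h1
  exact h1.trans (mul_le_mul_of_nonneg_right (le_abs_self C) (blochNorm_nonneg _))

theorem GoodInv.invertible {T : (ℂ → ℂ) → (ℂ → ℂ)} (h : GoodInv T)
    (hlin : ∀ f g z, T (fun z => 1 * f z - 1 * g z) z = 1 * T f z - 1 * T g z) :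
    InvertibleOnBloch T := by
  classical
  obtain ⟨hT, ⟨C, hC0, hC⟩, hs⟩ := h
  obtain ⟨C', hC'⟩ := id hT
  choose! S hS1 hS2 using hs
  refine ⟨hT, S, ⟨C, fun f hf => ⟨hS1 f hf, ?_⟩⟩, fun f hf => ⟨?_, hS2 f hf⟩⟩
  · have := hC _ (hS1 f hf)
    rwa [blochNorm_congr (hS2 f hf)] at this
  · have hTf := (hC' f hf).1
    have h1 := hS1 _ hTf
    have h2 := lin_bloch h1 hf 1 1
    have h3 := hC _ h2.1
    have h4 : Set.EqOn (T (fun z => 1 * S (T f) z - 1 * f z)) (fun _ => 0) D1 := by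
      intro z hz
      rw [hlin, hS2 _ hTf hz]
      ring
    have h5 : blochNorm (fun _ => (0 : ℂ)) = 0 := by
      simp [blochNorm, blochSemi]
    rw [blochNorm_congr h4, h5, mul_zero] at h3
    intro z hz
    have := bloch_eq_zero h2.1 h3 hz
    linear_combination this

theorem goodInv_iff (u φ : ℂ → ℂ) (lam : ℂ) :
    InvertibleOnBloch (fun f z => lam * f z - wco u φ f z) ↔
    GoodInv (fun f z => lam * f z - wco u φ f z) :=
  ⟨fun h => h.goodInv, fun h => h.invertible (by intro f g z; simp only [wco]; ring)⟩

theorem bdd_sub {T : (ℂ → ℂ) → (ℂ → ℂ)} (h : BddOnBloch T) (lam : ℂ) :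
    BddOnBloch (fun f z => lam * f z - T f z) := by
  obtain ⟨C, hC⟩ := h
  refine ⟨‖lam‖ + C, fun f hf => ?_⟩
  have h1 := lin_bloch hf (hC f hf).1 lam 1
  simp only [one_mul, norm_one] at h1
  refine ⟨h1.1, h1.2.trans ?_⟩
  have := (hC f hf).2
  linarith

/-! ### Hyperbolic maps: working interface -/

structure Hyp (φ : ℂ → ℂ) (a b : ℂ) (μ : ℝ) : Prop where
  ha : ‖a‖ = 1
  hb : ‖b‖ = 1
  hab : a ≠ b
  pos : 0 < μ
  lt : μ < 1
  maps : ∀ z ∈ D1, φ z ∈ D1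
  diff : DifferentiableOn ℂ φ D1
  der : ∀ z ∈ D1, (1 - ‖z‖ ^ 2) * ‖deriv φ z‖ = 1 - ‖φ z‖ ^ 2
  low : ∃ c : ℝ, 0 ≤ c ∧ ∀ z ∈ D1, ell (φ z) ≤ ell z + c
  cross : ∀ z ∈ D1, (φ z - a) * (z - b) = μ * ((z - a) * (φ z - b))

theorem sub_ne {a z : ℂ} (ha : ‖a‖ = 1) (hz : z ∈ D1) : z - a ≠ 0 := by
  intro h
  have := mem_D1.1 hz
  rw [sub_eq_zero.1 h, ha] at this
  exact lt_irrefl _ this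

theorem deriv_wco {u φ f : ℂ → ℂ} {a b : ℂ} {μ : ℝ} (H : Hyp φ a b μ) (hu : AnalyticOnD u)
    (hf : AnalyticOnD f) {z : ℂ} (hz : z ∈ D1) :
    deriv (wco u φ f) z = deriv u z * f (φ z) + u z * (deriv f (φ z) * deriv φ z) := by
  have h1 := (hu.differentiableAt (isOpen_D1.mem_nhds hz)).hasDerivAt
  have h2 := (H.diff.differentiableAt (isOpen_D1.mem_nhds hz)).hasDerivAt
  have h3 := (hf.differentiableAt (isOpen_D1.mem_nhds (H.maps z hz))).hasDerivAt
  exact (h1.mul (h3.comp z h2)).deriv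

theorem wco_analytic {u φ f : ℂ → ℂ} {a b : ℂ} {μ : ℝ} (H : Hyp φ a b μ) (hu : AnalyticOnD u)
    (hf : AnalyticOnD f) : AnalyticOnD (wco u φ f) :=
  DifferentiableOn.mul hu (DifferentiableOn.comp hf H.diff H.maps)

theorem wco_iter (u φ f : ℂ → ℂ) (n : ℕ) (z : ℂ) :
    (wco u φ)^[n] f z = wprod u φ n z * f (φ^[n] z) := by
  induction n generalizing z with
  | zero => simp [wprod]
  | succ n ih =>
    rw [Function.iterate_succ_apply', wco, ih, wprod, wprod, Finset.prod_range_succ',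
      Function.iterate_succ_apply]
    simp only [Function.iterate_succ_apply, Function.iterate_zero, id]
    ring

theorem disc_bound {u : ℂ → ℂ} (hu : InDiscAlgebra u) :
    ∃ M : ℝ, 0 < M ∧ ∀ z ∈ D1, ‖u z‖ ≤ M := by
  obtain ⟨M, hM⟩ := (isCompact_closedBall (0:ℂ) 1).exists_bound_of_continuousOn hu.1
  exact ⟨max M 1, by positivity, fun z hz => (hM z (ball_subset_closedBall hz)).trans (le_max_left _ _)⟩

/-- test functions -/
theorem log_test {w : ℂ} (hw : w ∈ D1) :
    ∃ f : ℂ → ℂ, InBloch f ∧ blochNorm f ≤ 2 ∧ ‖f w‖ = ell w - 1 := by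
  have hw1 := mem_D1.1 hw
  have hlt : ∀ z ∈ D1, ‖(starRingEnd ℂ) w * z‖ < 1 := by
    intro z hz
    have := mem_D1.1 hz
    rw [norm_mul, RCLike.norm_conj]
    nlinarith [norm_nonneg w, norm_nonneg z]
  have hslit : ∀ z ∈ D1, 1 - (starRingEnd ℂ) w * z ∈ slitPlane := by
    intro z hz
    left
    have := (Complex.abs_re_le_norm ((starRingEnd ℂ) w * z)).trans_lt (hlt z hz)
    have := (abs_lt.1 this).2
    simp only [sub_re, one_re]
    linarith
  have hd : ∀ z ∈ D1, HasDerivAt (fun z => Complex.log (1 - (starRingEnd ℂ) w * z))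
      (-(starRingEnd ℂ) w / (1 - (starRingEnd ℂ) w * z)) z := by
    intro z hz
    have h1 : HasDerivAt (fun z => 1 - (starRingEnd ℂ) w * z) (-(starRingEnd ℂ) w) z := by
      simpa using ((hasDerivAt_id z).const_mul ((starRingEnd ℂ) w)).const_sub 1
    exact h1.clog (hslit z hz)
  have key : ∀ z ∈ D1, (1 - ‖z‖ ^ 2) *
      ‖deriv (fun z => Complex.log (1 - (starRingEnd ℂ) w * z)) z‖ ≤ 2 := by
    intro z hz
    have hz1 := mem_D1.1 hz
    rw [(hd z hz).deriv, norm_div, norm_neg, RCLike.norm_conj]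
    have h1 : 1 - ‖z‖ ≤ ‖1 - (starRingEnd ℂ) w * z‖ := by
      have h2 := norm_sub_norm_le (1:ℂ) ((starRingEnd ℂ) w * z)
      rw [norm_one, norm_mul, RCLike.norm_conj] at h2
      nlinarith [norm_nonneg w, norm_nonneg z]
    have h3 : 0 < ‖1 - (starRingEnd ℂ) w * z‖ := by linarith
    rw [← mul_div_assoc, div_le_iff₀ h3]
    have h4 := one_sub_sq_pos hz
    nlinarith [norm_nonneg w, norm_nonneg z]
  refine ⟨fun z => Complex.log (1 - (starRingEnd ℂ) w * z),
    ⟨fun z hz => (hd z hz).differentiableAt.differentiableWithinAt, 2, key⟩, ?_, ?_⟩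
  · have := semi_le key
    simp only [blochNorm, mul_zero, sub_zero, Complex.log_one, norm_zero, zero_add]
    exact this
  · have h1 : 1 - (starRingEnd ℂ) w * w = ((1 - ‖w‖ ^ 2 : ℝ) : ℂ) := by
      rw [mul_comm, Complex.mul_conj, Complex.normSq_eq_norm_sq]
      push_cast; ring
    have h2 := one_le_ell hw
    simp only [h1]
    rw [← Complex.ofReal_log (one_sub_sq_pos hw).le, Complex.norm_real, Real.norm_eq_abs, abs_of_nonpos]
    · unfold ell; ring
    · unfold ell at h2; linarith

theorem mult_cond {u φ : ℂ → ℂ} {a b : ℂ} {μ : ℝ} (H : Hyp φ a b μ) (hu : InDiscAlgebra u)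
    (hT : BddOnBloch (wco u φ)) :
    ∃ M : ℝ, 0 ≤ M ∧ ∀ z ∈ D1, (1 - ‖z‖ ^ 2) * ‖deriv u z‖ * ell (φ z) ≤ M := by
  obtain ⟨C, hC⟩ := hT
  obtain ⟨Mu, hMu0, hMu⟩ := disc_bound hu
  have hub := bloch_of_bounded hu.2 hMu
  refine ⟨2 * |C| + 5 * Mu, by positivity, fun z hz => ?_⟩
  obtain ⟨f, hf, hf2, hfw⟩ := log_test (H.maps z hz)
  have h0 := one_sub_sq_pos hz
  have h1 := semi_bound (hC f hf).1 hz
  have h2 : blochSemi (wco u φ f) ≤ |C| * 2 := by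
    have h3 := (hC f hf).2
    have h4 : C * blochNorm f ≤ |C| * 2 :=
      mul_le_mul (le_abs_self C) hf2 (blochNorm_nonneg _) (abs_nonneg _)
    have : blochSemi (wco u φ f) ≤ blochNorm (wco u φ f) := by
      unfold blochNorm; linarith [norm_nonneg (wco u φ f 0)]
    linarith
  have h5 : ‖deriv u z‖ * (ell (φ z) - 1) ≤
      ‖deriv (wco u φ f) z‖ + ‖u z‖ * (‖deriv f (φ z)‖ * ‖deriv φ z‖) := by
    rw [← hfw, ← norm_mul, ← norm_mul, ← norm_mul]
    have e : deriv u z * f (φ z) = deriv (wco u φ f) z - u z * (deriv f (φ z) * deriv φ z) := by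
      rw [deriv_wco H hu.2 hf.1 hz]; ring
    rw [e]
    exact norm_sub_le _ _
  have h6 : (1 - ‖z‖ ^ 2) * (‖u z‖ * (‖deriv f (φ z)‖ * ‖deriv φ z‖)) ≤ Mu * 2 := by
    have e : (1 - ‖z‖ ^ 2) * (‖u z‖ * (‖deriv f (φ z)‖ * ‖deriv φ z‖)) =
      ‖u z‖ * ((1 - ‖φ z‖ ^ 2) * ‖deriv f (φ z)‖) := by rw [← H.der z hz]; ring
    rw [e]
    have h7 := semi_bound hf (H.maps z hz)
    have h8 : blochSemi f ≤ 2 := by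
      unfold blochNorm at hf2; linarith [norm_nonneg (f 0)]
    exact mul_le_mul (hMu z hz) (h7.trans h8)
      (mul_nonneg (one_sub_sq_pos (H.maps z hz)).le (norm_nonneg _)) hMu0.le
  have h9 := semi_bound hub.1 hz
  have h10 : blochSemi u ≤ 3 * Mu := by
    have := hub.2
    unfold blochNorm at this; linarith [norm_nonneg (u 0)]
  have h11 := mul_le_mul_of_nonneg_left h5 h0.le
  have e : (1 - ‖z‖ ^ 2) * ‖deriv u z‖ * ell (φ z) =
    (1 - ‖z‖ ^ 2) * (‖deriv u z‖ * (ell (φ z) - 1)) + (1 - ‖z‖ ^ 2) * ‖deriv u z‖ := by ring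
  rw [e]
  rw [mul_add] at h11
  linarith

theorem tele {μ x : ℝ} (h0 : 0 < μ) (h1 : μ < 1) (hx : 0 ≤ x) :
    (1 - μ) * (x / (1 + x) ^ 2) ≤ (x / μ) / (1 + x / μ) - x / (1 + x) := by
  have e : (x / μ) / (1 + x / μ) - x / (1 + x) = (1 - μ) * (x / ((μ + x) * (1 + x))) := by
    field_simp
    ring
  rw [e]
  have : 0 < μ + x := by linarith
  apply mul_le_mul_of_nonneg_left _ (by linarith)
  apply div_le_div_of_nonneg_left hx (by positivity)
  nlinarith

theorem Hyp.ratio {φ : ℂ → ℂ} {a b : ℂ} {μ : ℝ} (H : Hyp φ a b μ) {z : ℂ} (hz : z ∈ D1) :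
    (φ z - a) / (φ z - b) = μ * ((z - a) / (z - b)) := by
  have h1 := sub_ne H.hb hz
  have h2 := sub_ne H.hb (H.maps z hz)
  have := H.cross z hz
  field_simp
  linear_combination this

theorem cocycle {u φ : ℂ → ℂ} {a b : ℂ} {μ : ℝ} (H : Hyp φ a b μ) (hu : InDiscAlgebra u)
    {R : ℝ} (ha : ‖u a‖ < R) (hb : ‖u b‖ < R) :
    ∃ (E : ℂ → ℝ) (Em : ℝ), ∀ z ∈ D1, 1 ≤ E z ∧ E z ≤ Em ∧ ‖u z‖ * E (φ z) ≤ R * E z := by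
  obtain ⟨Mu, hMu0, hMu⟩ := disc_bound hu
  have hR : 0 < R := (norm_nonneg _).trans_lt ha
  have near : ∀ c : ℂ, ‖c‖ = 1 → ‖u c‖ < R →
      ∃ δ > 0, ∀ z ∈ D1, ‖z - c‖ < δ → ‖u z‖ < R := by
    intro c hc hcR
    have h1 : ContinuousWithinAt (fun z => ‖u z‖) (closedBall 0 1) c :=
      (hu.1 c (by simp [hc])).norm
    have h2 := h1.eventually (gt_mem_nhds hcR)
    rw [Filter.Eventually, Metric.mem_nhdsWithin_iff] at h2
    obtain ⟨δ, hδ, h3⟩ := h2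
    refine ⟨δ, hδ, fun z hz hzc => h3 ⟨?_, ball_subset_closedBall hz⟩⟩
    simpa [dist_eq_norm] using hzc
  obtain ⟨δ1, hδ1, h1⟩ := near a H.ha ha
  obtain ⟨δ2, hδ2, h2⟩ := near b H.hb hb
  set δ := min δ1 δ2
  have hδ : 0 < δ := lt_min hδ1 hδ2
  have hμ := H.lt
  have hμ0 := H.pos
  set K : ℝ := Mu / R * (16 / ((1 - μ) * δ ^ 2)) with hK
  have hKpos : 0 < K := by
    have : 0 < 1 - μ := by linarith
    positivity
  set x : ℂ → ℝ := fun z => ‖z - a‖ / ‖z - b‖ with hxdef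
  have hx0 : ∀ z, 0 ≤ x z := fun z => by positivity
  have hxφ : ∀ z ∈ D1, x (φ z) = μ * x z := by
    intro z hz
    have := congrArg norm (H.ratio hz)
    rw [norm_div, norm_mul, norm_div, Complex.norm_real, Real.norm_eq_abs, abs_of_pos hμ0] at this
    exact this
  have hG : ∀ y : ℝ, 0 ≤ y → 0 ≤ y / (1 + y) ∧ y / (1 + y) ≤ 1 := by
    intro y hy
    refine ⟨by positivity, ?_⟩
    rw [div_le_one (by positivity)]
    linarith
  refine ⟨fun z => Real.exp (K * ((x z / μ) / (1 + x z / μ))), Real.exp K, fun z hz => ?_⟩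
  have hy := hG (x z / μ) (div_nonneg (hx0 z) hμ0.le)
  refine ⟨Real.one_le_exp (by have := hy.1; positivity), Real.exp_le_exp.2 (by nlinarith [hy.2]), ?_⟩
  have hzb : 0 < ‖z - b‖ := norm_pos_iff.2 (sub_ne H.hb hz)
  have hza : 0 < ‖z - a‖ := norm_pos_iff.2 (sub_ne H.ha hz)
  have ht := tele hμ0 hμ (hx0 z)
  have main : ‖u z‖ ≤ R * Real.exp (K * ((x z / μ) / (1 + x z / μ) - x z / (1 + x z))) := by
    by_cases hcase : ‖z - a‖ < δ ∨ ‖z - b‖ < δ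
    · have h3 : ‖u z‖ < R := by
        rcases hcase with h | h
        · exact h1 z hz (h.trans_le (min_le_left _ _))
        · exact h2 z hz (h.trans_le (min_le_right _ _))
      have h4 : 0 ≤ (1 - μ) * (x z / (1 + x z) ^ 2) :=
        mul_nonneg (by linarith) (div_nonneg (hx0 z) (by positivity))
      have h5 : 1 ≤ Real.exp (K * ((x z / μ) / (1 + x z / μ) - x z / (1 + x z))) :=
        Real.one_le_exp (mul_nonneg hKpos.le (h4.trans ht))
      nlinarith
    · push Not at hcase
      have hz1 := mem_D1.1 hz
      have hza2 : ‖z - a‖ ≤ 2 := by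
        have := norm_sub_le z a; rw [H.ha] at this; linarith
      have hzb2 : ‖z - b‖ ≤ 2 := by
        have := norm_sub_le z b; rw [H.hb] at this; linarith
      have h3 : δ ^ 2 / 16 ≤ x z / (1 + x z) ^ 2 := by
        have e : x z / (1 + x z) ^ 2 = (‖z - a‖ * ‖z - b‖) / (‖z - b‖ + ‖z - a‖) ^ 2 := by
          simp only [hxdef]
          field_simp
        rw [e]
        apply div_le_div₀ (by positivity) _ (by positivity) _
        · rw [pow_two]; exact mul_le_mul hcase.1 hcase.2 hδ.le hza.le
        · nlinarith
      have h4 : Mu / R ≤ K * ((x z / μ) / (1 + x z / μ) - x z / (1 + x z)) := by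
        have h1μ : 0 < 1 - μ := by linarith
        calc Mu / R = K * ((1 - μ) * (δ ^ 2 / 16)) := by rw [hK]; field_simp
          _ ≤ _ := by
            apply mul_le_mul_of_nonneg_left _ hKpos.le
            exact (mul_le_mul_of_nonneg_left h3 h1μ.le).trans ht
      have h5 := Real.add_one_le_exp (K * ((x z / μ) / (1 + x z / μ) - x z / (1 + x z)))
      have h6 : Mu / R ≤ Real.exp (K * ((x z / μ) / (1 + x z / μ) - x z / (1 + x z))) := by linarith
      rw [div_le_iff₀ hR] at h6
      linarith [hMu z hz]
  have e1 : x (φ z) / μ = x z := by rw [hxφ z hz]; field_simp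
  beta_reduce
  rw [e1]
  have e2 : R * Real.exp (K * ((x z / μ) / (1 + x z / μ))) =
     R * Real.exp (K * ((x z / μ) / (1 + x z / μ) - x z / (1 + x z))) *
      Real.exp (K * (x z / (1 + x z))) := by
    rw [mul_assoc R (Real.exp _) (Real.exp _), ← Real.exp_add]; congr 2; ring
  rw [e2]
  exact mul_le_mul_of_nonneg_right main (Real.exp_pos _).le

/-! ### Power bounds and the Neumann series -/

theorem power_bound {u φ : ℂ → ℂ} {a b : ℂ} {μ : ℝ} (H : Hyp φ a b μ) (hu : InDiscAlgebra u)
    (hT : BddOnBloch (wco u φ)) {R : ℝ} (ha : ‖u a‖ < R) (hb : ‖u b‖ < R) :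
    ∃ Q : ℝ, 0 ≤ Q ∧ ∀ f, InBloch f → ∀ n : ℕ, InBloch ((wco u φ)^[n] f) ∧ ∀ z ∈ D1,
      ‖(wco u φ)^[n] f z‖ ≤ Q * ell z * blochNorm f * ((1 + n) ^ 2 * R ^ n) ∧
      (1 - ‖z‖ ^ 2) * ‖deriv ((wco u φ)^[n] f) z‖ ≤
        Q * blochNorm f * ((1 + n) ^ 2 * R ^ n) := by
  have hR : 0 < R := (norm_nonneg _).trans_lt ha
  obtain ⟨M, hM0, hM⟩ := mult_cond H hu hT
  obtain ⟨E, Em, hE⟩ := cocycle H hu ha hb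
  obtain ⟨c, hc0, hc⟩ := H.low
  have hEm : 1 ≤ Em := (hE 0 zero_mem_D1).1.trans (hE 0 zero_mem_D1).2.1
  obtain ⟨C, hC⟩ := id hT
  set Q0 : ℝ := 1 + M * Em * (1 + c) / R with hQ0
  have hQ01 : 1 ≤ Q0 := by
    have : 0 ≤ M * Em * (1 + c) / R := by positivity
    linarith
  have hin : ∀ f, InBloch f → ∀ n : ℕ, InBloch ((wco u φ)^[n] f) := by
    intro f hf n
    induction n with
    | zero => simpa using hf
    | succ n ih => rw [Function.iterate_succ_apply']; exact (hC _ ih).1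
  have g1 : ∀ f, InBloch f → ∀ n : ℕ, ∀ z ∈ D1,
      ‖(wco u φ)^[n] f z‖ ≤ R ^ n * E z * (ell z + c * n) * blochNorm f := by
    intro f hf n
    have hN := blochNorm_nonneg f
    induction n with
    | zero =>
      intro z hz
      have h1 := bloch_growth hf hz
      have h2 := one_le_ell hz
      have h3 := (hE z hz).1
      simp only [Function.iterate_zero, id, pow_zero, Nat.cast_zero, mul_zero, add_zero, one_mul]
      have h4 : 0 ≤ blochNorm f * ell z := by positivity
      nlinarith
    | succ n ih =>
      intro z hz
      rw [Function.iterate_succ_apply']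
      simp only [wco, norm_mul]
      have h1 := ih (φ z) (H.maps z hz)
      have h2 := (hE z hz).2.2
      have h3 := hc z hz
      have h5 := one_le_ell (H.maps z hz)
      have h6 := (hE (φ z) (H.maps z hz)).1
      have h7 := one_le_ell hz
      calc ‖u z‖ * ‖(wco u φ)^[n] f (φ z)‖
          ≤ ‖u z‖ * (R ^ n * E (φ z) * (ell (φ z) + c * n) * blochNorm f) := by gcongr
        _ = (‖u z‖ * E (φ z)) * (R ^ n * (ell (φ z) + c * n) * blochNorm f) := by ring
        _ ≤ (R * E z) * (R ^ n * (ell (φ z) + c * n) * blochNorm f) := by gcongr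
        _ ≤ (R * E z) * (R ^ n * ((ell z + c) + c * n) * blochNorm f) := by
          have := (hE z hz).1
          gcongr
        _ = _ := by push_cast; ring
  have g2 : ∀ f, InBloch f → ∀ n : ℕ, ∀ z ∈ D1,
      (1 - ‖z‖ ^ 2) * ‖deriv ((wco u φ)^[n] f) z‖ ≤
        R ^ n * E z * Q0 * (1 + n) ^ 2 * blochNorm f := by
    intro f hf n
    have hN := blochNorm_nonneg f
    induction n with
    | zero =>
      intro z hz
      have h1 := semi_bound hf hz
      have h2 : blochSemi f ≤ blochNorm f := by unfold blochNorm; linarith [norm_nonneg (f 0)]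
      have h3 := (hE z hz).1
      simp only [Function.iterate_zero, id, pow_zero, Nat.cast_zero, add_zero, one_mul, one_pow, mul_one]
      have h4 : 1 * 1 * blochNorm f ≤ E z * Q0 * blochNorm f := by gcongr
      linarith
    | succ n ih =>
      intro z hz
      have hz' := H.maps z hz
      rw [Function.iterate_succ_apply', deriv_wco H hu.2 (hin f hf n).1 hz]
      set g := (wco u φ)^[n] f with hg
      have h0 := one_sub_sq_pos hz
      have h1 := ih (φ z) hz'
      have h2 := (hE z hz).2.2
      have h5 := one_le_ell hz'
      have h6 := (hE (φ z) hz').1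
      have h6' := (hE (φ z) hz').2.1
      have h7 := (hE z hz).1
      have h8 := g1 f hf n (φ z) hz'
      have A : (1 - ‖z‖ ^ 2) * (‖deriv u z‖ * ‖g (φ z)‖) ≤
          R ^ (n+1) * E z * Q0 * (1 + n) * blochNorm f := by
        have h9 : (ell (φ z) + c * n) ≤ ell (φ z) * (1 + c) * (1 + n) := by
          have e : ell (φ z) * (1 + c) * (1 + n) - (ell (φ z) + c * n) =
            (ell (φ z) - 1) * (c * n) + ell (φ z) * n + ell (φ z) * c := by ring
          have : 0 ≤ (ell (φ z) - 1) * (c * n) + ell (φ z) * n + ell (φ z) * c := by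
            have : 0 ≤ ell (φ z) - 1 := by linarith
            positivity
          linarith
        calc (1 - ‖z‖ ^ 2) * (‖deriv u z‖ * ‖g (φ z)‖)
            ≤ (1 - ‖z‖ ^ 2) * (‖deriv u z‖ * (R ^ n * E (φ z) * (ell (φ z) + c * n) * blochNorm f)) := by
              gcongr
          _ ≤ (1 - ‖z‖ ^ 2) * (‖deriv u z‖ *
                (R ^ n * Em * (ell (φ z) * (1 + c) * (1 + n)) * blochNorm f)) := by
              gcongr
          _ = ((1 - ‖z‖ ^ 2) * ‖deriv u z‖ * ell (φ z)) *
                (R ^ n * Em * (1 + c) * (1 + n) * blochNorm f) := by ring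
          _ ≤ M * (R ^ n * Em * (1 + c) * (1 + n) * blochNorm f) := by
              have := hM z hz
              gcongr
          _ = R ^ (n + 1) * 1 * (M * Em * (1 + c) / R) * (1 + n) * blochNorm f := by
              field_simp
              ring
          _ ≤ _ := by
              have : M * Em * (1 + c) / R ≤ Q0 := by rw [hQ0]; linarith
              gcongr
      have B : (1 - ‖z‖ ^ 2) * (‖u z‖ * (‖deriv g (φ z)‖ * ‖deriv φ z‖)) ≤
          R ^ (n+1) * E z * Q0 * (1 + n) ^ 2 * blochNorm f := by
        have e : (1 - ‖z‖ ^ 2) * (‖u z‖ * (‖deriv g (φ z)‖ * ‖deriv φ z‖)) =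
          ‖u z‖ * ((1 - ‖φ z‖ ^ 2) * ‖deriv g (φ z)‖) := by rw [← H.der z hz]; ring
        rw [e]
        calc _ ≤ ‖u z‖ * (R ^ n * E (φ z) * Q0 * (1 + n) ^ 2 * blochNorm f) := by gcongr
          _ = (‖u z‖ * E (φ z)) * (R ^ n * Q0 * (1 + n) ^ 2 * blochNorm f) := by ring
          _ ≤ (R * E z) * (R ^ n * Q0 * (1 + n) ^ 2 * blochNorm f) := by gcongr
          _ = _ := by ring
      have D : ‖deriv u z * g (φ z) + u z * (deriv g (φ z) * deriv φ z)‖ ≤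
          ‖deriv u z‖ * ‖g (φ z)‖ + ‖u z‖ * (‖deriv g (φ z)‖ * ‖deriv φ z‖) := by
        refine (norm_add_le _ _).trans ?_
        rw [norm_mul, norm_mul, norm_mul]
      calc _ ≤ (1 - ‖z‖ ^ 2) * (‖deriv u z‖ * ‖g (φ z)‖ +
              ‖u z‖ * (‖deriv g (φ z)‖ * ‖deriv φ z‖)) := by gcongr
        _ ≤ R ^ (n+1) * E z * Q0 * (1 + n) * blochNorm f +
            R ^ (n+1) * E z * Q0 * (1 + n) ^ 2 * blochNorm f := by rw [mul_add]; linarith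
        _ = R ^ (n+1) * E z * Q0 * ((1 + n) + (1 + n) ^ 2) * blochNorm f := by ring
        _ ≤ R ^ (n+1) * E z * Q0 * (1 + (n + 1 : ℕ)) ^ 2 * blochNorm f := by
          gcongr
          push_cast
          nlinarith [(Nat.cast_nonneg n : (0:ℝ) ≤ n)]
  refine ⟨Em * Q0 * (1 + c), by positivity, fun f hf n => ⟨hin f hf n, fun z hz => ⟨?_, ?_⟩⟩⟩
  · have hN := blochNorm_nonneg f
    have h1 := one_le_ell hz
    have h2 := (hE z hz)
    have hn : (0:ℝ) ≤ n := Nat.cast_nonneg n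
    have h9 : (ell z + c * n) ≤ ell z * (1 + c) * (1 + n) ^ 2 := by
      have h10 : ell z + c * n ≤ ell z * (1 + c) * (1 + n) := by
        have : 0 ≤ (ell z - 1) * (c * n) + ell z * n + ell z * c := by
          have : 0 ≤ ell z - 1 := by linarith
          positivity
        linarith
      refine h10.trans ?_
      have : (1 + (n:ℝ)) ≤ (1 + n) ^ 2 := by nlinarith
      gcongr
    calc _ ≤ R ^ n * E z * (ell z + c * n) * blochNorm f := g1 f hf n z hz
      _ ≤ R ^ n * (Em * Q0) * (ell z * (1 + c) * (1 + n) ^ 2) * blochNorm f := by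
        have h3 : E z ≤ Em * Q0 := by nlinarith [h2.2.1]
        have : 0 ≤ E z := by linarith
        gcongr
      _ = _ := by ring
  · have hN := blochNorm_nonneg f
    have h2 := (hE z hz)
    calc _ ≤ R ^ n * E z * Q0 * (1 + n) ^ 2 * blochNorm f := g2 f hf n z hz
      _ ≤ R ^ n * Em * Q0 * (1 + n) ^ 2 * blochNorm f := by
        have := h2.2.1
        gcongr
      _ = Em * Q0 * 1 * blochNorm f * ((1 + n) ^ 2 * R ^ n) := by ring
      _ ≤ _ := by
        gcongr
        linarith

theorem summ_aux {q : ℝ} (h0 : 0 ≤ q) (h1 : q < 1) :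
    Summable (fun n : ℕ => (1 + (n:ℝ)) ^ 2 * q ^ n) := by
  have hq : ‖q‖ < 1 := by rwa [Real.norm_eq_abs, abs_of_nonneg h0]
  have a0 := summable_pow_mul_geometric_of_norm_lt_one 0 hq
  have a1 := summable_pow_mul_geometric_of_norm_lt_one 1 hq
  have a2 := summable_pow_mul_geometric_of_norm_lt_one 2 hq
  refine ((a0.add (a1.mul_left 2)).add a2).congr fun n => ?_
  ring

theorem ell_mono {z w : ℂ} (hz : ‖z‖ ≤ ‖w‖) (hw : w ∈ D1) : ell z ≤ ell w := by
  have := one_sub_sq_pos hw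
  have h2 : 1 - ‖w‖ ^ 2 ≤ 1 - ‖z‖ ^ 2 := by nlinarith [norm_nonneg z]
  have := Real.log_le_log this h2
  unfold ell; linarith

/-- the Neumann series -/
def neu (u φ : ℂ → ℂ) (lam : ℂ) (f : ℂ → ℂ) : ℂ → ℂ :=
  fun z => ∑' n : ℕ, (wco u φ)^[n] f z / lam ^ (n + 1)

theorem neumann {u φ : ℂ → ℂ} {a b : ℂ} {μ : ℝ} (H : Hyp φ a b μ) (hu : InDiscAlgebra u)
    (hT : BddOnBloch (wco u φ)) {lam : ℂ} (ha : ‖u a‖ < ‖lam‖) (hb : ‖u b‖ < ‖lam‖) :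
    ∃ K : ℝ, 0 ≤ K ∧ ∀ f, InBloch f →
      (∀ z ∈ D1, Summable (fun n : ℕ => (wco u φ)^[n] f z / lam ^ (n + 1))) ∧
      InBloch (neu u φ lam f) ∧ blochNorm (neu u φ lam f) ≤ K * blochNorm f := by
  obtain ⟨R, hR1, hR2⟩ := exists_between (max_lt ha hb)
  have haR := (le_max_left _ _).trans_lt hR1
  have hbR := (le_max_right _ _).trans_lt hR1
  have hR : 0 < R := (norm_nonneg _).trans_lt haR
  have hl : 0 < ‖lam‖ := hR.trans hR2
  obtain ⟨Q, hQ0, hQ⟩ := power_bound H hu hT haR hbR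
  have hs := summ_aux (q := R / ‖lam‖) (by positivity) ((div_lt_one hl).2 hR2)
  set s : ℕ → ℝ := fun n => (1 + (n:ℝ)) ^ 2 * (R / ‖lam‖) ^ n with hsdef
  have hs0 : ∀ n, 0 ≤ s n := fun n => by simp only [hsdef]; positivity
  have hS0 : 0 ≤ ∑' n, s n := tsum_nonneg hs0
  have conv : ∀ (A : ℝ) (n : ℕ), A * ((1 + n) ^ 2 * R ^ n) / ‖lam‖ ^ (n + 1) = A / ‖lam‖ * s n := by
    intro A n
    simp only [hsdef, div_pow]
    field_simp
    ring
  refine ⟨Q / ‖lam‖ * (∑' n, s n) + Q * ell 0 / ‖lam‖ * (∑' n, s n), ?_, fun f hf => ?_⟩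
  · have := one_le_ell zero_mem_D1
    positivity
  have hN := blochNorm_nonneg f
  have hterm : ∀ z ∈ D1, ∀ n : ℕ, ‖(wco u φ)^[n] f z / lam ^ (n + 1)‖ ≤
      Q * ell z * blochNorm f / ‖lam‖ * s n := by
    intro z hz n
    rw [norm_div, norm_pow, ← conv]
    have := ((hQ f hf n).2 z hz).1
    gcongr
  have hsum : ∀ z ∈ D1, Summable (fun n : ℕ => (wco u φ)^[n] f z / lam ^ (n + 1)) := fun z hz =>
    Summable.of_norm_bounded (hs.mul_left _) (hterm z hz)
  have hder : ∀ z ∈ D1, DifferentiableAt ℂ (neu u φ lam f) z ∧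
      HasSum (fun n : ℕ => deriv ((wco u φ)^[n] f) z / lam ^ (n + 1)) (deriv (neu u φ lam f) z) := by
    intro z hz
    obtain ⟨ρ, h1, h2⟩ := exists_between (mem_D1.1 hz)
    have hρ : 0 < ρ := (norm_nonneg _).trans_lt h1
    have hρn : ‖(ρ : ℂ)‖ = ρ := by rw [Complex.norm_real, Real.norm_eq_abs, abs_of_pos hρ]
    have hρD : (ρ : ℂ) ∈ D1 := by rw [mem_D1, hρn]; exact h2
    have hsub : ball (0:ℂ) ρ ⊆ D1 := ball_subset_ball h2.le
    have hzb : z ∈ ball (0:ℂ) ρ := by simpa using h1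
    have hdiff : ∀ n : ℕ, DifferentiableOn ℂ (fun z => (wco u φ)^[n] f z / lam ^ (n + 1)) (ball 0 ρ) :=
      fun n => ((hQ f hf n).1.1.mono hsub).div_const _
    have hbd : ∀ (n : ℕ) (w : ℂ), w ∈ ball (0:ℂ) ρ → ‖(wco u φ)^[n] f w / lam ^ (n + 1)‖ ≤
        Q * ell ρ * blochNorm f / ‖lam‖ * s n := by
      intro n w hw
      refine (hterm w (hsub hw) n).trans ?_
      have h3 : ell w ≤ ell ρ := ell_mono (by
        rw [hρn]
        have : ‖w‖ < ρ := by simpa using hw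
        exact this.le) hρD
      have := hs0 n
      gcongr
    have d1 := Complex.differentiableOn_tsum_of_summable_norm (hs.mul_left _) hdiff isOpen_ball hbd
    have d2 := Complex.hasSum_deriv_of_summable_norm (hs.mul_left _) hdiff isOpen_ball hbd hzb
    refine ⟨d1.differentiableAt (isOpen_ball.mem_nhds hzb), ?_⟩
    refine HasSum.congr_fun ?_ ?_ (f := fun n : ℕ => deriv (fun z => (wco u φ)^[n] f z / lam ^ (n + 1)) z)
    · exact d2
    · intro n
      simp
  have key : ∀ z ∈ D1, (1 - ‖z‖ ^ 2) * ‖deriv (neu u φ lam f) z‖ ≤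
      Q * blochNorm f / ‖lam‖ * (∑' n, s n) := by
    intro z hz
    have h0 := one_sub_sq_pos hz
    have h1 := (hder z hz).2.mul_left (((1 - ‖z‖ ^ 2 : ℝ)) : ℂ)
    have e : (1 - ‖z‖ ^ 2) * ‖deriv (neu u φ lam f) z‖ =
        ‖(((1 - ‖z‖ ^ 2 : ℝ)) : ℂ) * deriv (neu u φ lam f) z‖ := by
      rw [norm_mul, Complex.norm_real, Real.norm_eq_abs, abs_of_pos h0]
    rw [e, ← h1.tsum_eq, ← tsum_mul_left]
    refine tsum_of_norm_bounded (hs.mul_left _).hasSum fun n => ?_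
    rw [norm_mul, Complex.norm_real, Real.norm_eq_abs, abs_of_pos h0, norm_div, norm_pow, ← conv,
      ← mul_div_assoc]
    have := ((hQ f hf n).2 z hz).2
    gcongr
  refine ⟨hsum, ⟨fun z hz => (hder z hz).1.differentiableWithinAt, _, key⟩, ?_⟩
  have h1 := semi_le key
  have h2 : ‖neu u φ lam f 0‖ ≤ Q * ell 0 * blochNorm f / ‖lam‖ * (∑' n, s n) := by
    rw [← tsum_mul_left]
    exact tsum_of_norm_bounded (hs.mul_left _).hasSum (hterm 0 zero_mem_D1)
  unfold blochNorm at h1 h2 ⊢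
  refine (add_le_add h2 h1).trans (le_of_eq ?_)
  ring

theorem neu_eq {u φ : ℂ → ℂ} {a b : ℂ} {μ : ℝ} (H : Hyp φ a b μ) {lam : ℂ} (hl : lam ≠ 0)
    {f : ℂ → ℂ} (hs : ∀ z ∈ D1, Summable (fun n : ℕ => (wco u φ)^[n] f z / lam ^ (n + 1)))
    {z : ℂ} (hz : z ∈ D1) :
    lam * neu u φ lam f z - wco u φ (neu u φ lam f) z = f z := by
  have h1 := (hs z hz).tsum_eq_zero_add
  have h2 : wco u φ (neu u φ lam f) z =
      lam * ∑' n : ℕ, (wco u φ)^[n + 1] f z / lam ^ (n + 1 + 1) := by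
    simp only [wco, neu]
    rw [← tsum_mul_left, ← tsum_mul_left]
    congr 1
    funext n
    rw [Function.iterate_succ_apply']
    simp only [wco]
    field_simp
    ring
  rw [h2]
  simp only [neu]
  rw [h1]
  simp
  field_simp
  ring

theorem resolventB {u φ : ℂ → ℂ} {a b : ℂ} {μ : ℝ} (H : Hyp φ a b μ) (hu : InDiscAlgebra u)
    (hT : BddOnBloch (wco u φ)) {lam : ℂ} (ha : ‖u a‖ < ‖lam‖) (hb : ‖u b‖ < ‖lam‖) :
    GoodInv (fun f z => lam * f z - wco u φ f z) := by
  have hl : lam ≠ 0 := norm_pos_iff.1 ((norm_nonneg _).trans_lt ha)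
  obtain ⟨K, hK0, hK⟩ := neumann H hu hT ha hb
  have hB := bdd_sub hT lam
  obtain ⟨C, hC⟩ := id hB
  refine ⟨hB, ⟨K, hK0, fun h hh => ?_⟩, fun f hf => ⟨neu u φ lam f, (hK f hf).2.1, fun z hz => ?_⟩⟩
  · have h1 := (hK _ (hC h hh).1)
    have h2 : Set.EqOn (neu u φ lam (fun z => lam * h z - wco u φ h z)) h D1 := by
      intro z hz
      have hlin : ∀ n : ℕ, ∀ z, (wco u φ)^[n] (fun z => lam * h z - wco u φ h z) z =
          lam * (wco u φ)^[n] h z - (wco u φ)^[n + 1] h z := by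
        intro n z
        rw [wco_iter, wco_iter, Function.iterate_succ_apply, wco_iter]
        ring
      have hs := (hK h hh).1 z hz
      simp only [neu]
      have hs2 : Summable (fun n : ℕ => (wco u φ)^[n] h z / lam ^ n) := by
        refine (hs.mul_left lam).congr fun n => ?_
        field_simp
        ring
      have hs3 := (summable_nat_add_iff 1).2 hs2
      have e : (fun n : ℕ => (wco u φ)^[n] (fun z => lam * h z - wco u φ h z) z / lam ^ (n + 1)) =
          fun n => (wco u φ)^[n] h z / lam ^ n - (wco u φ)^[n + 1] h z / lam ^ (n + 1) := by
        funext n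
        rw [hlin]
        field_simp
        ring
      rw [e, hs2.tsum_sub hs3, hs2.tsum_eq_zero_add]
      simp
    rw [blochNorm_congr h2] at h1
    exact h1.2.2
  · exact neu_eq H hl (hK f hf).1 hz

/-! ### Half-plane coordinate and approximate interpolation along orbits -/

def Wf (a b z : ℂ) : ℂ := ((starRingEnd ℂ) a * b - 1) * ((z - a) / (z - b))

theorem re_lt_one {a b : ℂ} (ha : ‖a‖ = 1) (hb : ‖b‖ = 1) (hab : a ≠ b) :
    ((starRingEnd ℂ) a * b).re < 1 := by
  have h1 : a.re ^ 2 + a.im ^ 2 = 1 := by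
    have := Complex.sq_norm a
    rw [ha, Complex.normSq_apply] at this; nlinarith
  have h2 : b.re ^ 2 + b.im ^ 2 = 1 := by
    have := Complex.sq_norm b
    rw [hb, Complex.normSq_apply] at this; nlinarith
  simp only [mul_re, conj_re, conj_im]
  by_contra hcon
  push Not at hcon
  apply hab
  have h3 : (a.re - b.re) ^ 2 + (a.im - b.im) ^ 2 ≤ 0 := by nlinarith
  apply Complex.ext
  · nlinarith [sq_nonneg (a.re - b.re), sq_nonneg (a.im - b.im)]
  · nlinarith [sq_nonneg (a.re - b.re), sq_nonneg (a.im - b.im)]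

theorem Wf_re {a b z : ℂ} (ha : ‖a‖ = 1) (hb : ‖b‖ = 1) :
    (Wf a b z).re = (1 - ‖z‖ ^ 2) * (1 - ((starRingEnd ℂ) a * b).re) / ‖z - b‖ ^ 2 := by
  have h1 : a.re ^ 2 + a.im ^ 2 = 1 := by
    have := Complex.sq_norm a
    rw [ha, Complex.normSq_apply] at this; nlinarith
  have h2 : b.re ^ 2 + b.im ^ 2 = 1 := by
    have := Complex.sq_norm b
    rw [hb, Complex.normSq_apply] at this; nlinarith
  have e : Wf a b z = (((starRingEnd ℂ) a * b - 1) * ((z - a) * (starRingEnd ℂ) (z - b))) *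
      (((‖z - b‖ ^ 2)⁻¹ : ℝ) : ℂ) := by
    unfold Wf
    rw [div_eq_mul_inv, Complex.inv_def, Complex.normSq_eq_norm_sq]
    ring
  rw [e, Complex.re_mul_ofReal, ← div_eq_mul_inv]
  congr 1
  rw [Complex.sq_norm, Complex.normSq_apply]
  simp only [mul_re, mul_im, sub_re, sub_im, conj_re, conj_im, one_re, one_im]
  linear_combination (1 - z.re * b.re - z.im * b.im) * h1 -
    ((z.re * a.re + z.im * a.im) - (a.re ^ 2 + a.im ^ 2)) * h2

theorem Wf_re_pos {a b z : ℂ} (ha : ‖a‖ = 1) (hb : ‖b‖ = 1) (hab : a ≠ b) (hz : z ∈ D1) :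
    0 < (Wf a b z).re := by
  rw [Wf_re ha hb]
  have h1 := one_sub_sq_pos hz
  have h2 := re_lt_one ha hb hab
  have h3 : 0 < ‖z - b‖ := norm_pos_iff.2 (sub_ne hb hz)
  have : 0 < 1 - ((starRingEnd ℂ) a * b).re := by linarith
  positivity

theorem Wf_surj {a b : ℂ} (ha : ‖a‖ = 1) (hb : ‖b‖ = 1) (hab : a ≠ b) :
    ∃ z ∈ D1, Wf a b z = ((1 : ℝ) : ℂ) := by
  have h2 := re_lt_one ha hb hab
  set k : ℂ := (starRingEnd ℂ) a * b - 1 with hk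
  have hkre : k.re < 0 := by simp only [hk, sub_re, one_re]; linarith
  have hk0 : k ≠ 0 := by intro h; rw [h] at hkre; simp at hkre
  have hk1 : k - 1 ≠ 0 := by
    intro h
    have : k = 1 := by linear_combination h
    rw [this] at hkre; simp at hkre; linarith
  have hzb : (a * k - b) / (k - 1) - b = (a - b) * k / (k - 1) := by
    field_simp; ring
  have hza : (a * k - b) / (k - 1) - a = (a - b) / (k - 1) := by
    field_simp; ring
  have hab' : a - b ≠ 0 := sub_ne_zero.2 hab
  have hW : Wf a b ((a * k - b) / (k - 1)) = ((1 : ℝ) : ℂ) := by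
    unfold Wf
    rw [hzb, hza, ← hk]
    push_cast
    field_simp
  refine ⟨(a * k - b) / (k - 1), ?_, hW⟩
  have h3 := Wf_re (z := (a * k - b) / (k - 1)) ha hb
  rw [hW, Complex.ofReal_re, hzb] at h3
  have h4 : 0 < ‖(a - b) * k / (k - 1)‖ := norm_pos_iff.2 (by
    exact div_ne_zero (mul_ne_zero hab' hk0) hk1)
  rw [eq_div_iff (by positivity)] at h3
  rw [mem_D1]
  by_contra hcon
  push Not at hcon
  have h5 : 0 < 1 - ((starRingEnd ℂ) a * b).re := by linarith
  have h6 : 0 < ‖(a - b) * k / (k - 1)‖ ^ 2 := by positivity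
  have h7 : 0 ≤ ‖(a * k - b) / (k - 1)‖ ^ 2 - 1 := by nlinarith
  nlinarith

theorem Hyp.iter_mem {φ : ℂ → ℂ} {a b : ℂ} {μ : ℝ} (H : Hyp φ a b μ) {z : ℂ} (hz : z ∈ D1) (n : ℕ) :
    φ^[n] z ∈ D1 := by
  induction n with
  | zero => simpa using hz
  | succ n ih => rw [Function.iterate_succ_apply']; exact H.maps _ ih

theorem Hyp.iter_W {φ : ℂ → ℂ} {a b : ℂ} {μ : ℝ} (H : Hyp φ a b μ) {z : ℂ} (hz : z ∈ D1) {s : ℝ}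
    (hs : Wf a b z = s) (n : ℕ) : Wf a b (φ^[n] z) = ((s * μ ^ n : ℝ) : ℂ) := by
  induction n with
  | zero => simpa using hs
  | succ n ih =>
    rw [Function.iterate_succ_apply']
    unfold Wf at ih ⊢
    rw [H.ratio (H.iter_mem hz n)]
    push_cast at ih ⊢
    rw [pow_succ]
    linear_combination (μ : ℂ) * ih

theorem tele_sum {μ x : ℝ} (h0 : 0 < μ) (h1 : μ < 1) (hx : 0 ≤ x) (N : ℕ) :
    ∑ m ∈ Finset.range N, (x / μ ^ m) / (1 + x / μ ^ m) ^ 2 ≤ 1 / (1 - μ) := by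
  have h2 : 0 < 1 - μ := by linarith
  rw [le_div_iff₀ h2, mul_comm, Finset.mul_sum]
  have h3 : ∀ m : ℕ, (1 - μ) * ((x / μ ^ m) / (1 + x / μ ^ m) ^ 2) ≤
      (fun m : ℕ => (x / μ ^ m) / (1 + x / μ ^ m)) (m + 1) -
        (fun m : ℕ => (x / μ ^ m) / (1 + x / μ ^ m)) m := by
    intro m
    have := tele h0 h1 (x := x / μ ^ m) (by positivity)
    beta_reduce
    have e : x / μ ^ (m + 1) = x / μ ^ m / μ := by rw [pow_succ, div_div]
    rw [e]
    exact this
  refine (Finset.sum_le_sum fun m _ => h3 m).trans ?_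
  rw [Finset.sum_range_sub (fun m : ℕ => (x / μ ^ m) / (1 + x / μ ^ m)) N]
  beta_reduce
  have h4 : (x / μ ^ N) / (1 + x / μ ^ N) ≤ 1 := by
    have : 0 ≤ x / μ ^ N := by positivity
    rw [div_le_one (by positivity)]
    linarith
  have h5 : 0 ≤ (x / μ ^ 0) / (1 + x / μ ^ 0) := by positivity
  linarith

def kap (x : ℂ) : ℂ := 4 * x / (1 + x) ^ 2

theorem kap_bound {x : ℂ} (hx : 0 ≤ x.re) :
    ‖kap x‖ ≤ 8 * (‖x‖ / (1 + ‖x‖) ^ 2) ∧ ‖kap x‖ ≤ 2 := by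
  have h1 : (1 + ‖x‖) ^ 2 ≤ 2 * ‖1 + x‖ ^ 2 := by
    have e : ‖1 + x‖ ^ 2 = 1 + 2 * x.re + ‖x‖ ^ 2 := by
      rw [Complex.sq_norm, Complex.sq_norm, Complex.normSq_apply, Complex.normSq_apply]
      simp only [add_re, add_im, one_re, one_im]; ring
    rw [e]
    nlinarith [sq_nonneg (1 - ‖x‖)]
  have h0 := norm_nonneg x
  have h2 : 0 < ‖1 + x‖ ^ 2 := by nlinarith
  have h3 : ‖kap x‖ ≤ 8 * (‖x‖ / (1 + ‖x‖) ^ 2) := by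
    unfold kap
    rw [norm_div, norm_mul, norm_pow, ← mul_div_assoc, div_le_div_iff₀ h2 (by positivity)]
    have : ‖(4:ℂ)‖ = 4 := by simp
    rw [this]
    nlinarith
  refine ⟨h3, h3.trans ?_⟩
  rw [← mul_div_assoc, div_le_iff₀ (by positivity)]
  nlinarith [sq_nonneg (1 - ‖x‖)]

theorem kap_small {μ y : ℝ} (h0 : 0 < μ) (h1 : μ < 1) (hy : 0 < y) (h : y ≤ μ ∨ 1 / μ ≤ y) :
    4 * y / (1 + y) ^ 2 ≤ 4 * μ / (1 + μ) ^ 2 := by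
  rw [div_le_div_iff₀ (by positivity) (by positivity)]
  have : 0 ≤ (μ - y) * (1 - μ * y) := by
    rcases h with h | h
    · exact mul_nonneg (by linarith) (by nlinarith)
    · rw [div_le_iff₀ h0] at h
      exact mul_nonneg_of_nonpos_of_nonpos (by nlinarith) (by linarith)
  nlinarith

theorem interp {μ : ℝ} (h0 : 0 < μ) (h1 : μ < 1) {a b : ℂ} (ha : ‖a‖ = 1) (hb : ‖b‖ = 1)
    (hab : a ≠ b) :
    ∃ M : ℝ, 0 ≤ M ∧ ∀ (s : ℝ) (N : ℕ) (ε : ℕ → ℂ), 0 < s → (∀ n, ‖ε n‖ ≤ 1) →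
      ∃ f : ℂ → ℂ, AnalyticOnD f ∧ (∀ z ∈ D1, ‖f z‖ ≤ M) ∧
        ∀ (n : ℕ), ∀ z ∈ D1, Wf a b z = ((s * μ ^ n : ℝ) : ℂ) →
          ‖f z - (if n < N then ε n else 0)‖ ≤ 1 / 2 := by
  have h1μ : 0 < 1 - μ := by linarith
  set k : ℝ := 4 * μ / (1 + μ) ^ 2 with hk
  have hk0 : 0 ≤ k := by positivity
  have hk1 : k < 1 := by
    rw [hk, div_lt_one (by positivity)]
    nlinarith
  obtain ⟨p, hp⟩ := exists_pow_lt_of_lt_one (show 0 < (1 - μ) / 8 by linarith) hk1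
  refine ⟨2 ^ p * 8 * (1 / (1 - μ)), by positivity, fun s N ε hs hε => ?_⟩
  have hre : ∀ z ∈ D1, ∀ m : ℕ, 0 ≤ (Wf a b z / ((s * μ ^ m : ℝ) : ℂ)).re := by
    intro z hz m
    rw [Complex.div_ofReal_re]
    have := Wf_re_pos ha hb hab hz
    positivity
  refine ⟨fun z => ∑ m ∈ Finset.range N, ε m * kap (Wf a b z / ((s * μ ^ m : ℝ) : ℂ)) ^ (p + 1),
    ?_, ?_, ?_⟩
  · intro z hz
    apply DifferentiableAt.differentiableWithinAt
    apply DifferentiableAt.fun_sum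
    intro m _
    apply DifferentiableAt.const_mul
    apply DifferentiableAt.pow
    have hW : DifferentiableAt ℂ (fun z => Wf a b z / ((s * μ ^ m : ℝ) : ℂ)) z := by
      unfold Wf
      apply DifferentiableAt.div_const
      apply DifferentiableAt.const_mul
      exact (differentiableAt_id.sub_const a).div (differentiableAt_id.sub_const b) (sub_ne hb hz)
    unfold kap
    apply DifferentiableAt.div
    · exact hW.const_mul 4
    · exact (hW.const_add 1).pow 2
    · apply pow_ne_zero
      intro h
      have := congrArg Complex.re h
      have h3 := hre z hz m
      simp only [add_re, one_re, zero_re] at this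
      linarith
  · intro z hz
    refine (norm_sum_le _ _).trans ?_
    have h3 := tele_sum h0 h1 (x := ‖Wf a b z‖ / s) (by positivity) N
    refine le_trans ?_ (mul_le_mul_of_nonneg_left h3 (by positivity))
    rw [Finset.mul_sum]
    apply Finset.sum_le_sum
    intro m _
    have h4 := kap_bound (hre z hz m)
    have e : ‖Wf a b z / ((s * μ ^ m : ℝ) : ℂ)‖ = ‖Wf a b z‖ / s / μ ^ m := by
      rw [norm_div, Complex.norm_real, Real.norm_eq_abs, abs_of_pos (by positivity), div_div]
    rw [e] at h4
    rw [norm_mul, norm_pow, pow_succ]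
    calc _ ≤ 1 * (2 ^ p * (8 * (‖Wf a b z‖ / s / μ ^ m / (1 + ‖Wf a b z‖ / s / μ ^ m) ^ 2))) := by
          gcongr
          · exact hε m
          · exact h4.2
          · exact h4.1
      _ = _ := by ring
  · intro n z hz hWz
    have e : (if n < N then ε n else 0) = ∑ m ∈ Finset.range N, if m = n then ε m else 0 := by
      rw [Finset.sum_ite_eq']
      simp
    rw [e, ← Finset.sum_sub_distrib]
    refine (norm_sum_le _ _).trans ?_
    have h3 := tele_sum h0 h1 (x := μ ^ n) (by positivity) N
    have h4 : k ^ p * 4 * (1 / (1 - μ)) ≤ 1 / 2 := by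
      rw [mul_one_div, div_le_iff₀ h1μ]
      linarith
    refine le_trans ?_ ((mul_le_mul_of_nonneg_left h3 (by positivity)).trans h4)
    rw [Finset.mul_sum]
    apply Finset.sum_le_sum
    intro m _
    have e2 : Wf a b z / ((s * μ ^ m : ℝ) : ℂ) = ((μ ^ n / μ ^ m : ℝ) : ℂ) := by
      rw [hWz, ← Complex.ofReal_div]
      congr 1
      field_simp
    rw [e2]
    by_cases hmn : m = n
    · rw [if_pos hmn, hmn, div_self (by positivity)]
      have : kap ((1:ℝ) : ℂ) = 1 := by unfold kap; norm_num
      rw [this]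
      simp
      positivity
    · rw [if_neg hmn, sub_zero, norm_mul, norm_pow]
      set y : ℝ := μ ^ n / μ ^ m with hy
      have hy0 : 0 < y := by positivity
      have e3 : ‖kap (y : ℂ)‖ = 4 * y / (1 + y) ^ 2 := by
        have : kap (y : ℂ) = ((4 * y / (1 + y) ^ 2 : ℝ) : ℂ) := by unfold kap; push_cast; ring
        rw [this, Complex.norm_real, Real.norm_eq_abs, abs_of_pos (by positivity)]
      have hsm : 4 * y / (1 + y) ^ 2 ≤ k := by
        apply kap_small h0 h1 hy0
        rcases lt_or_gt_of_ne hmn with h | h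
        · left
          rw [hy, div_le_iff₀ (by positivity), ← pow_succ']
          exact pow_le_pow_of_le_one h0.le h1.le h
        · right
          rw [hy, div_le_div_iff₀ h0 (by positivity), one_mul, ← pow_succ]
          exact pow_le_pow_of_le_one h0.le h1.le h
      rw [e3, pow_succ]
      calc _ ≤ 1 * (k ^ p * (4 * y / (1 + y) ^ 2)) := by
            gcongr
            exact hε m
        _ = _ := by ring

/-! ### Lower estimate lemma -/

theorem lower_aux {u φ : ℂ → ℂ} {a b : ℂ} {μ : ℝ} (H : Hyp φ a b μ) (hu : InDiscAlgebra u)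
    (hT : BddOnBloch (wco u φ)) {lam : ℂ} (hl : lam ≠ 0) (ha : ‖u a‖ = ‖lam‖)
    (hb : ‖u b‖ = ‖lam‖) {C1 : ℝ} (hC0 : 0 ≤ C1)
    (hC : ∀ h, InBloch h → blochNorm h ≤ C1 * blochNorm (fun z => lam * h z - wco u φ h z)) :
    ∃ C : ℝ, ∀ lt : ℂ, ‖lam‖ < ‖lt‖ → ‖lt‖ ≤ 2 * ‖lam‖ → C1 * ‖lt - lam‖ ≤ 1 / 2 →
      ∀ z ∈ D1, ∀ s : ℝ, 0 < s → Wf a b z = (s : ℂ) → ∀ N : ℕ,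
      ∑ n ∈ Finset.range N, ‖wprod u φ n z‖ / ‖lt‖ ^ n ≤ C * ell z := by
  obtain ⟨M, hM0, hM⟩ := interp H.pos H.lt H.ha H.hb H.hab
  refine ⟨2 * (2 * ‖lam‖ * (2 * (C1 * (3 * M)))), fun lt h1 h2 h3 z hz s hs hW N => ?_⟩
  have hlt : lt ≠ 0 := norm_pos_iff.1 ((norm_nonneg _).trans_lt h1)
  obtain ⟨K, hK0, hK⟩ := neumann H hu hT (lam := lt) (by rw [ha]; exact h1) (by rw [hb]; exact h1)
  set c : ℕ → ℂ := fun n => wprod u φ n z / lt ^ n with hc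
  have hcn : ∀ n, ‖c n‖ = ‖wprod u φ n z‖ / ‖lt‖ ^ n := by
    intro n; simp only [hc, norm_div, norm_pow]
  have hsum : Summable (fun n => ‖c n‖) := by
    have h4 := bloch_of_bounded (f := fun _ => (1:ℂ)) (M := 1) (differentiableOn_const _)
      (by intro z _; simp)
    have h5 := ((hK _ h4.1).1 z hz).mul_left lt
    refine Summable.congr h5.norm (fun n => ?_)
    rw [wco_iter, mul_one, pow_succ]
    congr 1
    simp only [hc]
    field_simp
  have key : ∀ N : ℕ, ∑ n ∈ Finset.range N, ‖c n‖ ≤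
      2 * ‖lam‖ * (2 * (C1 * (3 * M))) * ell z + (∑' n, ‖c n‖) / 2 := by
    intro N
    obtain ⟨f, hf1, hf2, hf3⟩ := hM s N (fun n => (starRingEnd ℂ) (c n) / ‖c n‖) hs (by
      intro n
      rw [norm_div, RCLike.norm_conj, Complex.norm_real, norm_norm]
      exact div_self_le_one _)
    obtain ⟨hfb, hfn⟩ := bloch_of_bounded hf1 hf2
    obtain ⟨hs1, hg, -⟩ := hK f hfb
    set g := neu u φ lt f with hgdef
    have hgn : blochNorm g ≤ 2 * (C1 * (3 * M)) := by
      have h4 := hC g hg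
      have h5 : EqOn (fun z => lam * g z - wco u φ g z) (fun z => 1 * f z - (lt - lam) * g z) D1 := by
        intro w hw
        have := neu_eq H hlt hs1 hw
        simp only
        rw [← this]
        ring
      rw [blochNorm_congr h5] at h4
      have h6 := (lin_bloch hfb hg 1 (lt - lam)).2
      rw [norm_one, one_mul] at h6
      have h7 := blochNorm_nonneg g
      have h8 := h4.trans (mul_le_mul_of_nonneg_left h6 hC0)
      have h9 : C1 * blochNorm f ≤ C1 * (3 * M) := mul_le_mul_of_nonneg_left hfn hC0
      nlinarith [mul_le_mul_of_nonneg_right h3 h7]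
    have hgz : ‖lt * g z‖ ≤ 2 * ‖lam‖ * (2 * (C1 * (3 * M))) * ell z := by
      have h4 := bloch_growth hg hz
      have h5 := one_le_ell hz
      rw [norm_mul, mul_assoc]
      refine mul_le_mul h2 (h4.trans ?_) (norm_nonneg _) (by positivity)
      exact mul_le_mul_of_nonneg_right hgn (by linarith)
    have hd : HasSum (fun n => c n * f (φ^[n] z)) (lt * g z) := by
      have h5 := (hs1 z hz).hasSum.mul_left lt
      have h6 : (fun n => c n * f (φ^[n] z)) = fun n => lt * ((wco u φ)^[n] f z / lt ^ (n + 1)) := by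
        funext n
        rw [wco_iter, pow_succ]
        simp only [hc]
        field_simp
      rw [h6]
      exact h5
    have he : HasSum (fun n => if n < N then ((‖c n‖ : ℝ) : ℂ) else 0)
        (∑ n ∈ Finset.range N, ((‖c n‖ : ℝ) : ℂ)) := by
      have h5 : HasSum (fun n => if n < N then ((‖c n‖ : ℝ) : ℂ) else 0)
          (∑ n ∈ Finset.range N, if n < N then ((‖c n‖ : ℝ) : ℂ) else 0) :=
        hasSum_sum_of_ne_finset_zero
          (by intro n hn; rw [Finset.mem_range] at hn; exact if_neg hn)
      convert h5 using 1
      apply Finset.sum_congr rfl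
      intro n hn
      rw [if_pos (Finset.mem_range.1 hn)]
    have hde := hd.sub he
    have hb1 : ‖lt * g z - ∑ n ∈ Finset.range N, ((‖c n‖ : ℝ) : ℂ)‖ ≤ (∑' n, ‖c n‖) / 2 := by
      rw [← hde.tsum_eq]
      refine tsum_of_norm_bounded (hsum.hasSum.div_const 2) (fun n => ?_)
      have h5 := hf3 n _ (H.iter_mem hz n) (H.iter_W hz hW n)
      have h6 : c n * f (φ^[n] z) - (if n < N then ((‖c n‖ : ℝ) : ℂ) else 0) =
          c n * (f (φ^[n] z) - (if n < N then (starRingEnd ℂ) (c n) / ‖c n‖ else 0)) := by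
        split_ifs with hn
        · rw [mul_sub, ← mul_div_assoc, Complex.mul_conj, Complex.normSq_eq_norm_sq]
          by_cases h0 : c n = 0
          · simp [h0]
          · have : (‖c n‖ : ℂ) ≠ 0 := by exact_mod_cast norm_ne_zero_iff.2 h0
            push_cast
            field_simp
        · ring
      rw [h6, norm_mul, div_eq_mul_one_div ‖c n‖]
      exact mul_le_mul_of_nonneg_left h5 (norm_nonneg _)
    have hb2 : ‖∑ n ∈ Finset.range N, ((‖c n‖ : ℝ) : ℂ)‖ = ∑ n ∈ Finset.range N, ‖c n‖ := by
      rw [← Complex.ofReal_sum, Complex.norm_real, Real.norm_eq_abs,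
        abs_of_nonneg (Finset.sum_nonneg fun _ _ => norm_nonneg _)]
    have hb3 := norm_sub_norm_le (∑ n ∈ Finset.range N, ((‖c n‖ : ℝ) : ℂ)) (lt * g z)
    rw [norm_sub_rev, hb2] at hb3
    linarith
  have hA := hsum.tsum_le_of_sum_range_le key
  have hN := hsum.sum_le_tsum (Finset.range N) (fun _ _ => norm_nonneg _)
  simp only [hcn] at hA hN
  linarith

theorem lower {u φ : ℂ → ℂ} {a b : ℂ} {μ : ℝ} (H : Hyp φ a b μ) (hu : InDiscAlgebra u)
    (hT : BddOnBloch (wco u φ)) {lam : ℂ} (hl : lam ≠ 0) (ha : ‖u a‖ = ‖lam‖)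
    (hb : ‖u b‖ = ‖lam‖) (hG : GoodInv (fun f z => lam * f z - wco u φ f z)) :
    ∃ C : ℝ, ∀ z ∈ D1, ∀ s : ℝ, 0 < s → Wf a b z = (s : ℂ) → ∀ N : ℕ,
      ∑ n ∈ Finset.range N, ‖wprod u φ n z‖ / ‖lam‖ ^ n ≤ C * ell z := by
  obtain ⟨C1, hC0, hC⟩ := hG.2.1
  obtain ⟨C, hL⟩ := lower_aux H hu hT hl ha hb hC0 hC
  refine ⟨C, fun z hz s hs hW N => ?_⟩
  have hln : 0 < ‖lam‖ := norm_pos_iff.2 hl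
  have htend : Tendsto (fun t : ℝ => ∑ n ∈ Finset.range N, ‖wprod u φ n z‖ / ‖(t : ℂ) * lam‖ ^ n)
      (nhdsWithin 1 (Set.Ioi 1)) (nhds (∑ n ∈ Finset.range N, ‖wprod u φ n z‖ / ‖lam‖ ^ n)) := by
    have : ContinuousAt (fun t : ℝ => ∑ n ∈ Finset.range N, ‖wprod u φ n z‖ / ‖(t : ℂ) * lam‖ ^ n) 1 := by
      apply tendsto_finsetSum
      intro n _
      apply ContinuousAt.div continuousAt_const
      · fun_prop
      · simp [hl]
    have h2 := this.tendsto.mono_left (nhdsWithin_le_nhds (s := Set.Ioi 1))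
    simpa using h2
  refine le_of_tendsto htend ?_
  have hlim : Tendsto (fun t : ℝ => C1 * ‖(t : ℂ) * lam - lam‖) (nhds 1) (nhds 0) := by
    have : Continuous (fun t : ℝ => C1 * ‖(t : ℂ) * lam - lam‖) := by fun_prop
    simpa using this.tendsto 1
  have h5 : ∀ᶠ t : ℝ in nhdsWithin 1 (Set.Ioi 1), C1 * ‖(t : ℂ) * lam - lam‖ < 1 / 2 :=
    (hlim.eventually_lt_const (by norm_num)).filter_mono nhdsWithin_le_nhds
  have h6 : ∀ᶠ t : ℝ in nhdsWithin 1 (Set.Ioi 1), t < 2 :=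
    (tendsto_id.eventually_lt_const (by norm_num : (1:ℝ) < 2)).filter_mono nhdsWithin_le_nhds
  filter_upwards [h5, h6, self_mem_nhdsWithin] with t ht5 ht6 ht7
  have ht1 : 1 < t := ht7
  have hn : ‖(t : ℂ) * lam‖ = t * ‖lam‖ := by
    rw [norm_mul, Complex.norm_real, Real.norm_eq_abs, abs_of_pos (by linarith)]
  refine hL _ ?_ ?_ ht5.le z hz s hs hW N
  · rw [hn]; nlinarith
  · rw [hn]; nlinarith

/-! ### Moebius maps -/

theorem mob_den {α z : ℂ} (hα : α ∈ D1) (hz : ‖z‖ ≤ 1) : 1 - (starRingEnd ℂ) α * z ≠ 0 := by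
  intro h
  have h1 : (starRingEnd ℂ) α * z = 1 := by linear_combination -h
  have h2 := congrArg norm h1
  rw [norm_mul, RCLike.norm_conj, norm_one] at h2
  have := mem_D1.1 hα
  nlinarith [norm_nonneg α, norm_nonneg z]

theorem mob_id {α z lam : ℂ} (hl : ‖lam‖ = 1) :
    ‖1 - (starRingEnd ℂ) α * z‖ ^ 2 - ‖lam * (α - z)‖ ^ 2 = (1 - ‖α‖ ^ 2) * (1 - ‖z‖ ^ 2) := by
  rw [norm_mul, hl, one_mul]
  simp only [Complex.sq_norm, Complex.normSq_apply, mul_re, mul_im, sub_re, sub_im, conj_re, conj_im,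
    one_re, one_im]
  ring

theorem mob_norm {φ : ℂ → ℂ} {α lam : ℂ} (hl : ‖lam‖ = 1) (hα : α ∈ D1)
    (hφ : ∀ z, φ z = lam * (α - z) / (1 - (starRingEnd ℂ) α * z)) {z : ℂ} (hz : ‖z‖ ≤ 1) :
    1 - ‖φ z‖ ^ 2 = (1 - ‖α‖ ^ 2) * (1 - ‖z‖ ^ 2) / ‖1 - (starRingEnd ℂ) α * z‖ ^ 2 := by
  have h1 := norm_pos_iff.2 (mob_den hα hz)
  rw [← mob_id hl, hφ, norm_div, div_pow, sub_div, div_self (by positivity)]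

theorem mob_deriv {φ : ℂ → ℂ} {α lam : ℂ} (hα : α ∈ D1)
    (hφ : ∀ z, φ z = lam * (α - z) / (1 - (starRingEnd ℂ) α * z)) {z : ℂ} (hz : ‖z‖ ≤ 1) :
    HasDerivAt φ (lam * (α * (starRingEnd ℂ) α - 1) / (1 - (starRingEnd ℂ) α * z) ^ 2) z := by
  have h0 := mob_den hα hz
  have e : φ = fun z => lam * (α - z) / (1 - (starRingEnd ℂ) α * z) := funext hφ
  rw [e]
  have h1 : HasDerivAt (fun z => lam * (α - z)) (lam * (-1)) z :=
    ((hasDerivAt_id z).const_sub α).const_mul lam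
  have h2 : HasDerivAt (fun z => 1 - (starRingEnd ℂ) α * z) (-((starRingEnd ℂ) α * 1)) z :=
    ((hasDerivAt_id z).const_mul _).const_sub 1
  have h3 := h1.fun_div h2 h0
  refine h3.congr_deriv ?_
  congr 1
  ring

theorem mob_maps {φ : ℂ → ℂ} {α lam : ℂ} (hl : ‖lam‖ = 1) (hα : α ∈ D1)
    (hφ : ∀ z, φ z = lam * (α - z) / (1 - (starRingEnd ℂ) α * z)) : ∀ z ∈ D1, φ z ∈ D1 := by
  intro z hz
  have h1 := mob_norm hl hα hφ (mem_D1.1 hz).le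
  have h2 := one_sub_sq_pos hz
  have h3 := one_sub_sq_pos hα
  have h4 := norm_pos_iff.2 (mob_den hα (mem_D1.1 hz).le)
  have h5 : 0 < 1 - ‖φ z‖ ^ 2 := by rw [h1]; positivity
  rw [mem_D1]
  nlinarith [norm_nonneg (φ z)]

theorem mob_maps_closed {φ : ℂ → ℂ} {α lam : ℂ} (hl : ‖lam‖ = 1) (hα : α ∈ D1)
    (hφ : ∀ z, φ z = lam * (α - z) / (1 - (starRingEnd ℂ) α * z)) :
    MapsTo φ (closedBall 0 1) (closedBall 0 1) := by
  intro z hz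
  rw [mem_closedBall_zero_iff] at hz ⊢
  have h1 := mob_norm hl hα hφ hz
  have h3 := one_sub_sq_pos hα
  have h2 : 0 ≤ 1 - ‖z‖ ^ 2 := by nlinarith [norm_nonneg z]
  have h5 : 0 ≤ 1 - ‖φ z‖ ^ 2 := by rw [h1]; positivity
  nlinarith [norm_nonneg (φ z)]

theorem mob_cont {φ : ℂ → ℂ} {α lam : ℂ} (hα : α ∈ D1)
    (hφ : ∀ z, φ z = lam * (α - z) / (1 - (starRingEnd ℂ) α * z)) :
    ContinuousOn φ (closedBall 0 1) := fun _ hz =>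
  (mob_deriv hα hφ (mem_closedBall_zero_iff.1 hz)).continuousAt.continuousWithinAt

theorem mob_diff {φ : ℂ → ℂ} {α lam : ℂ} (hα : α ∈ D1)
    (hφ : ∀ z, φ z = lam * (α - z) / (1 - (starRingEnd ℂ) α * z)) :
    DifferentiableOn ℂ φ D1 := fun _ hz =>
  (mob_deriv hα hφ (mem_D1.1 hz).le).differentiableAt.differentiableWithinAt

theorem mob_der {φ : ℂ → ℂ} {α lam : ℂ} (hl : ‖lam‖ = 1) (hα : α ∈ D1)
    (hφ : ∀ z, φ z = lam * (α - z) / (1 - (starRingEnd ℂ) α * z)) :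
    ∀ z ∈ D1, (1 - ‖z‖ ^ 2) * ‖deriv φ z‖ = 1 - ‖φ z‖ ^ 2 := by
  intro z hz
  have h3 := one_sub_sq_pos hα
  rw [mob_norm hl hα hφ (mem_D1.1 hz).le, (mob_deriv hα hφ (mem_D1.1 hz).le).deriv]
  have e : α * (starRingEnd ℂ) α - 1 = ((‖α‖ ^ 2 - 1 : ℝ) : ℂ) := by
    rw [Complex.mul_conj, Complex.normSq_eq_norm_sq]; push_cast; ring
  rw [e, norm_div, norm_mul, hl, norm_pow, Complex.norm_real, Real.norm_eq_abs,
    abs_of_neg (by linarith)]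
  ring

theorem mob_low {φ : ℂ → ℂ} {α lam : ℂ} (hl : ‖lam‖ = 1) (hα : α ∈ D1)
    (hφ : ∀ z, φ z = lam * (α - z) / (1 - (starRingEnd ℂ) α * z)) :
    ∃ c : ℝ, 0 ≤ c ∧ ∀ z ∈ D1, ell (φ z) ≤ ell z + c := by
  have h3 := one_sub_sq_pos hα
  refine ⟨-Real.log ((1 - ‖α‖ ^ 2) / 4), ?_, fun z hz => ?_⟩
  · have := Real.log_nonpos (x := (1 - ‖α‖ ^ 2) / 4) (by positivity) (by nlinarith [norm_nonneg α])
    linarith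
  · have h2 := one_sub_sq_pos hz
    have h4 := norm_pos_iff.2 (mob_den hα (mem_D1.1 hz).le)
    have h5 : ‖1 - (starRingEnd ℂ) α * z‖ ≤ 2 := by
      refine (norm_sub_le _ _).trans ?_
      rw [norm_one, norm_mul, RCLike.norm_conj]
      have := mem_D1.1 hα
      have := mem_D1.1 hz
      nlinarith [norm_nonneg α, norm_nonneg z]
    have h6 : (1 - ‖α‖ ^ 2) / 4 * (1 - ‖z‖ ^ 2) ≤ 1 - ‖φ z‖ ^ 2 := by
      rw [mob_norm hl hα hφ (mem_D1.1 hz).le, div_mul_eq_mul_div]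
      apply div_le_div_of_nonneg_left (by positivity) (by positivity)
      nlinarith
    have h7 := Real.log_le_log (by positivity) h6
    rw [Real.log_mul (by positivity) (by positivity)] at h7
    unfold ell
    linarith

theorem mob_inv {φ ψ : ℂ → ℂ} {α lam : ℂ} (hl : ‖lam‖ = 1) (hα : α ∈ D1)
    (hφ : ∀ z, φ z = lam * (α - z) / (1 - (starRingEnd ℂ) α * z))
    (hψ : ∀ z, ψ z = (starRingEnd ℂ) lam * (lam * α - z) / (1 - (starRingEnd ℂ) (lam * α) * z))
    {z : ℂ} (hz : ‖z‖ ≤ 1) : ψ (φ z) = z := by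
  have h0 := mob_den hα hz
  have h0c : 1 - z * (starRingEnd ℂ) α ≠ 0 := by rwa [mul_comm z]
  have h1 : lam * (starRingEnd ℂ) lam = 1 := by
    rw [Complex.mul_conj, Complex.normSq_eq_norm_sq, hl]; norm_num
  have h3 : (1 - α * (starRingEnd ℂ) α) ≠ 0 := by
    have := one_sub_sq_pos hα
    rw [Complex.mul_conj, Complex.normSq_eq_norm_sq]
    exact_mod_cast this.ne'
  have e1 : (starRingEnd ℂ) lam * (lam * α - φ z) =
      z * (1 - α * (starRingEnd ℂ) α) / (1 - (starRingEnd ℂ) α * z) := by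
    rw [hφ]
    field_simp
    linear_combination (α * (1 - (starRingEnd ℂ) α * z) - (α - z)) * h1
  have e2 : 1 - (starRingEnd ℂ) (lam * α) * φ z =
      (1 - α * (starRingEnd ℂ) α) / (1 - (starRingEnd ℂ) α * z) := by
    rw [hφ, map_mul]
    field_simp
    linear_combination (-(starRingEnd ℂ) α * (α - z)) * h1
  rw [hψ, e1, e2]
  field_simp

theorem mob_sub {φ : ℂ → ℂ} {α lam : ℂ} (hα : α ∈ D1)
    (hφ : ∀ z, φ z = lam * (α - z) / (1 - (starRingEnd ℂ) α * z)) {z w : ℂ} (hz : ‖z‖ ≤ 1)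
    (hw : ‖w‖ ≤ 1) :
    (φ z - φ w) * ((1 - (starRingEnd ℂ) α * z) * (1 - (starRingEnd ℂ) α * w)) =
      lam * (α * (starRingEnd ℂ) α - 1) * (z - w) := by
  have h1 := mob_den hα hz
  have h2 := mob_den hα hw
  have h1c : 1 - z * (starRingEnd ℂ) α ≠ 0 := by rwa [mul_comm z]
  have h2c : 1 - w * (starRingEnd ℂ) α ≠ 0 := by rwa [mul_comm w]
  rw [hφ, hφ]
  field_simp
  ring

/-- The working interface for a hyperbolic automorphism and its inverse. -/
theorem hyp_data {φ : ℂ → ℂ} {a b : ℂ} (hh : IsHyperbolicAuto φ a b) :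
    ∃ (μ : ℝ) (ψ : ℂ → ℂ), Hyp φ a b μ ∧ Hyp ψ b a μ ∧ (∀ z ∈ D1, ψ (φ z) = z) ∧
      (∀ z ∈ D1, φ (ψ z) = z) ∧ ψ a = a ∧ ψ b = b ∧ ContinuousOn ψ (closedBall 0 1) ∧
      MapsTo ψ (closedBall 0 1) (closedBall 0 1) := by
  obtain ⟨⟨lam, α, hl, hα, hφ⟩, ha, hb, hab, hfa, hfb, μ, h0, h1, hd⟩ := hh
  have hda := mob_den hα ha.le
  have hdb := mob_den hα hb.le
  have hP : (1 - (starRingEnd ℂ) α * a) * (1 - (starRingEnd ℂ) α * b) =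
      lam * (α * (starRingEnd ℂ) α - 1) := by
    have := mob_sub hα hφ ha.le hb.le
    rw [hfa, hfb] at this
    apply mul_left_cancel₀ (sub_ne_zero.2 hab)
    linear_combination this
  have hμ : (1 - (starRingEnd ℂ) α * b) = μ * (1 - (starRingEnd ℂ) α * a) := by
    rw [(mob_deriv hα hφ ha.le).deriv, ← hP] at hd
    rw [← hd]
    field_simp
  have H : Hyp φ a b μ := by
    refine ⟨ha, hb, hab, h0, h1, mob_maps hl hα hφ, mob_diff hα hφ, mob_der hl hα hφ,
      mob_low hl hα hφ, fun z hz => ?_⟩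
    have hz1 := (mem_D1.1 hz).le
    have hdz := mob_den hα hz1
    have e1 := mob_sub hα hφ hz1 ha.le
    have e2 := mob_sub hα hφ hz1 hb.le
    rw [hfa] at e1
    rw [hfb] at e2
    apply mul_right_cancel₀ (mul_ne_zero hdz hda)
    have e3 : (φ z - b) * ((1 - (starRingEnd ℂ) α * z) * (μ * (1 - (starRingEnd ℂ) α * a))) =
      lam * (α * (starRingEnd ℂ) α - 1) * (z - b) := by rw [← hμ]; exact e2
    linear_combination (z - b) * e1 - (z - a) * e3
  have hl2 : ‖(starRingEnd ℂ) lam‖ = 1 := by rw [RCLike.norm_conj, hl]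
  have hβ : lam * α ∈ D1 := by rw [mem_D1, norm_mul, hl, one_mul]; exact mem_D1.1 hα
  have hll : (starRingEnd ℂ) lam * lam = 1 := by
    rw [mul_comm, Complex.mul_conj, Complex.normSq_eq_norm_sq, hl]; norm_num
  set ψ : ℂ → ℂ := fun z =>
    (starRingEnd ℂ) lam * (lam * α - z) / (1 - (starRingEnd ℂ) (lam * α) * z) with hψd
  have hψ : ∀ z, ψ z =
    (starRingEnd ℂ) lam * (lam * α - z) / (1 - (starRingEnd ℂ) (lam * α) * z) := fun z => rfl
  have hinv1 : ∀ z : ℂ, ‖z‖ ≤ 1 → ψ (φ z) = z := fun z hz => mob_inv hl hα hφ hψ hz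
  have hinv2 : ∀ z : ℂ, ‖z‖ ≤ 1 → φ (ψ z) = z := fun z hz => by
    refine mob_inv hl2 hβ hψ ?_ hz
    intro w
    rw [← mul_assoc, hll, one_mul, Complex.conj_conj]
    exact hφ w
  refine ⟨μ, ψ, H, ?_, fun z hz => hinv1 z (mem_D1.1 hz).le, fun z hz => hinv2 z (mem_D1.1 hz).le,
    ?_, ?_, mob_cont hβ hψ, mob_maps_closed hl2 hβ hψ⟩
  · refine ⟨hb, ha, hab.symm, h0, h1, mob_maps hl2 hβ hψ, mob_diff hβ hψ, mob_der hl2 hβ hψ,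
      mob_low hl2 hβ hψ, fun z hz => ?_⟩
    have := H.cross (ψ z) (mob_maps hl2 hβ hψ z hz)
    rw [hinv2 z (mem_D1.1 hz).le] at this
    linear_combination this
  · have := hinv1 a ha.le; rwa [hfa] at this
  · have := hinv1 b hb.le; rwa [hfb] at this

/-! ### The weight is bounded below; the inverse operator; conclusion -/

theorem comp_bloch {φ : ℂ → ℂ} {a b : ℂ} {μ : ℝ} (H : Hyp φ a b μ) {f : ℂ → ℂ} (hf : InBloch f) :
    InBloch (fun z => f (φ z)) ∧ blochNorm (fun z => f (φ z)) ≤ (ell (φ 0) + 1) * blochNorm f := by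
  have key : ∀ z ∈ D1, (1 - ‖z‖ ^ 2) * ‖deriv (fun z => f (φ z)) z‖ ≤ blochSemi f := by
    intro z hz
    have h2 := (H.diff.differentiableAt (isOpen_D1.mem_nhds hz)).hasDerivAt
    have h3 := (hf.diffAt (H.maps z hz)).hasDerivAt
    have h4 : deriv (fun z => f (φ z)) z = deriv f (φ z) * deriv φ z := (h3.comp z h2).deriv
    have h5 := semi_bound hf (H.maps z hz)
    rw [h4, norm_mul]
    rw [← H.der z hz] at h5
    linarith
  refine ⟨⟨DifferentiableOn.comp hf.1 H.diff H.maps, _, key⟩, ?_⟩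
  have h1 := bloch_growth hf (H.maps 0 zero_mem_D1)
  have h2 := semi_le key
  have h3 := norm_nonneg (f 0)
  unfold blochNorm at h1 ⊢
  nlinarith

theorem pow_compare {x Q D : ℝ} (hQ : 0 < Q) (h : ∀ n : ℕ, x ^ n ≤ Q ^ n * D) : x ≤ Q := by
  by_contra hcon
  push Not at hcon
  have h1 : 1 < x / Q := by rwa [one_lt_div hQ]
  obtain ⟨n, hn⟩ := pow_unbounded_of_one_lt D h1
  rw [div_pow, lt_div_iff₀ (by positivity)] at hn
  linarith [h n]

theorem u_below {u φ : ℂ → ℂ} {a b : ℂ} {μ : ℝ} (H : Hyp φ a b μ) (hu : InDiscAlgebra u)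
    (hG : GoodInv (wco u φ)) : ∃ δ : ℝ, 0 < δ ∧ ∀ z ∈ closedBall (0:ℂ) 1, δ ≤ ‖u z‖ := by
  obtain ⟨hT, ⟨C1, hC0, hC⟩, hs⟩ := hG
  have he := one_le_ell (H.maps 0 zero_mem_D1)
  set Q : ℝ := (ell (φ 0) + 1) * C1 + 1 with hQ
  have hQ0 : 0 < Q := by positivity
  have step : ∀ n : ℕ, ∃ h, InBloch h ∧ blochNorm h ≤ Q ^ n * 3 ∧ ∀ z ∈ D1, h z * u z ^ n = 1 := by
    intro n
    induction n with
    | zero =>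
      have h4 := bloch_of_bounded (f := fun _ => (1:ℂ)) (M := 1) (differentiableOn_const _)
        (by intro z _; simp)
      exact ⟨_, h4.1, by linarith [h4.2], by intro z _; simp⟩
    | succ n ih =>
      obtain ⟨h, hh1, hh2, hh3⟩ := ih
      obtain ⟨g, hg1, hg2⟩ := hs h hh1
      obtain ⟨k1, k2⟩ := comp_bloch H hg1
      refine ⟨_, k1, ?_, fun z hz => ?_⟩
      · have h5 := hC g hg1
        rw [blochNorm_congr hg2] at h5
        have h6 := blochNorm_nonneg h
        calc _ ≤ (ell (φ 0) + 1) * blochNorm g := k2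
          _ ≤ (ell (φ 0) + 1) * (C1 * blochNorm h) := by gcongr
          _ ≤ Q * blochNorm h := by rw [hQ]; nlinarith
          _ ≤ Q * (Q ^ n * 3) := by gcongr
          _ = _ := by ring
      · have h5 : u z * g (φ z) = h z := hg2 hz
        rw [← hh3 z hz, ← h5]
        ring
  have hD : ∀ z ∈ D1, Q⁻¹ ≤ ‖u z‖ := by
    intro z hz
    have hne : u z ≠ 0 := by
      obtain ⟨h, -, -, h3⟩ := step 1
      intro h0
      have := h3 z hz
      rw [h0] at this
      simp at this
    have hp : 0 < ‖u z‖ := norm_pos_iff.2 hne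
    have : ‖u z‖⁻¹ ≤ Q := by
      apply pow_compare hQ0 (D := 3 * ell z)
      intro n
      obtain ⟨h, h1, h2, h3⟩ := step n
      have h4 := bloch_growth h1 hz
      have h5 := congrArg norm (h3 z hz)
      rw [norm_mul, norm_pow, norm_one] at h5
      have h6 : ‖u z‖⁻¹ ^ n = ‖h z‖ := by
        rw [inv_pow]
        exact (eq_inv_of_mul_eq_one_left h5).symm
      rw [h6]
      have h7 := one_le_ell hz
      refine h4.trans ?_
      rw [← mul_assoc]
      exact mul_le_mul_of_nonneg_right h2 (by linarith)
    exact inv_le_of_inv_le₀ hp this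
  refine ⟨Q⁻¹, by positivity, fun z hz => ?_⟩
  have h1 : z ∈ closure (ball (0:ℂ) 1) := by rwa [closure_ball _ one_ne_zero]
  have h2 : u z ∈ closure (u '' ball 0 1) :=
    ((hu.1 z hz).mono ball_subset_closedBall).mem_closure_image h1
  have h3 : IsClosed {w : ℂ | Q⁻¹ ≤ ‖w‖} := isClosed_le continuous_const continuous_norm
  exact closure_minimal (by rintro _ ⟨w, hw, rfl⟩; exact hD w hw) h3 h2

/-- mutually inverse weighted composition operators -/
structure InvPair (u φ v ψ : ℂ → ℂ) : Prop where
  m1 : ∀ z ∈ D1, φ z ∈ D1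
  m2 : ∀ z ∈ D1, ψ z ∈ D1
  i1 : ∀ z ∈ D1, ψ (φ z) = z
  i2 : ∀ z ∈ D1, φ (ψ z) = z
  w1 : ∀ z ∈ D1, v (φ z) * u z = 1
  w2 : ∀ z ∈ D1, u (ψ z) * v z = 1
  b1 : BddOnBloch (wco u φ)
  b2 : BddOnBloch (wco v ψ)

theorem InvPair.symm {u φ v ψ : ℂ → ℂ} (P : InvPair u φ v ψ) : InvPair v ψ u φ :=
  ⟨P.m2, P.m1, P.i2, P.i1, P.w2, P.w1, P.b2, P.b1⟩

theorem transfer {u φ v ψ : ℂ → ℂ} (P : InvPair u φ v ψ) {lam : ℂ} (hl : lam ≠ 0)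
    (hG : GoodInv (fun f z => lam * f z - wco u φ f z)) :
    GoodInv (fun f z => lam⁻¹ * f z - wco v ψ f z) := by
  obtain ⟨-, ⟨C1, hC0, hC⟩, hs⟩ := hG
  obtain ⟨CT, hCT⟩ := P.b1
  have hB := bdd_sub P.b2 lam⁻¹
  refine ⟨hB, ⟨C1 * (‖lam‖ * |CT|), by positivity, fun h hh => ?_⟩, fun f hf => ?_⟩
  · obtain ⟨C', hC'⟩ := hB
    set k : ℂ → ℂ := fun z => lam⁻¹ * h z - wco v ψ h z with hk
    have hkB : InBloch k := (hC' h hh).1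
    have h1 : EqOn (fun z => lam * h z - wco u φ h z)
        (fun z => (-lam) * wco u φ k z - 0 * wco u φ k z) D1 := by
      intro z hz
      simp only [wco, hk]
      rw [P.i1 z hz]
      have := P.w1 z hz
      have e : lam * lam⁻¹ = 1 := mul_inv_cancel₀ hl
      linear_combination (-lam * h z) * this + (u z * h (φ z)) * e
    have h2 := hC h hh
    rw [blochNorm_congr h1] at h2
    have h3 := (lin_bloch (hCT k hkB).1 (hCT k hkB).1 (-lam) 0).2
    rw [norm_neg, norm_zero, zero_mul, add_zero] at h3
    have h4 := (hCT k hkB).2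
    have h5 := blochNorm_nonneg k
    have h6 : CT * blochNorm k ≤ |CT| * blochNorm k :=
      mul_le_mul_of_nonneg_right (le_abs_self _) h5
    calc _ ≤ C1 * (‖lam‖ * (|CT| * blochNorm k)) := h2.trans (by gcongr; exact h3.trans (by gcongr; linarith))
      _ = _ := by ring
  · obtain ⟨h, hh, he⟩ := hs _ (hCT f hf).1
    refine ⟨_, (lin_bloch hh hh (-lam) 0).1, fun w hw => ?_⟩
    have h1 := he (P.m2 w hw)
    simp only [wco] at h1 ⊢
    rw [P.i2 w hw] at h1
    have h2 := P.w2 w hw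
    have e : lam⁻¹ * lam = 1 := inv_mul_cancel₀ hl
    linear_combination (v w) * h1 + (h w + f w) * h2 - h w * e

theorem good_neg {u φ : ℂ → ℂ} (hG : GoodInv (wco u φ)) :
    GoodInv (fun f z => 0 * f z - wco u φ f z) := by
  obtain ⟨hT, ⟨C1, hC0, hC⟩, hs⟩ := hG
  have hB := bdd_sub hT 0
  obtain ⟨C, hC'⟩ := id hB
  refine ⟨hB, ⟨C1, hC0, fun h hh => ?_⟩, fun f hf => ?_⟩
  · have h1 := (hC' h hh).1
    have h2 := (lin_bloch h1 h1 (-1) 0).2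
    rw [norm_neg, norm_one, norm_zero, zero_mul, add_zero, one_mul] at h2
    have h3 : EqOn (wco u φ h) (fun z => (-1) * (0 * h z - wco u φ h z) -
        0 * (0 * h z - wco u φ h z)) D1 := by
      intro z _; simp only; ring
    rw [← blochNorm_congr h3] at h2
    exact (hC h hh).trans (mul_le_mul_of_nonneg_left h2 hC0)
  · obtain ⟨h, hh, he⟩ := hs f hf
    refine ⟨_, (lin_bloch hh hh (-1) 0).1, fun w hw => ?_⟩
    have h1 := he hw
    simp only [wco] at h1 ⊢
    linear_combination h1

theorem wprod_inv {u φ v ψ : ℂ → ℂ} (P : InvPair u φ v ψ) {z : ℂ} (hz : z ∈ D1) (n : ℕ) :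
    φ^[n] z ∈ D1 ∧ wprod v ψ n (φ^[n] z) * wprod u φ n z = 1 := by
  induction n with
  | zero => simpa [wprod] using hz
  | succ n ih =>
    obtain ⟨h1, h2⟩ := ih
    rw [Function.iterate_succ_apply']
    refine ⟨P.m1 _ h1, ?_⟩
    have e1 : wprod v ψ (n + 1) (φ (φ^[n] z)) = wprod v ψ n (φ^[n] z) * v (φ (φ^[n] z)) := by
      unfold wprod
      rw [Finset.prod_range_succ']
      simp only [Function.iterate_succ_apply, Function.iterate_zero, id]
      rw [P.i1 _ h1]
    have e2 : wprod u φ (n + 1) z = wprod u φ n z * u (φ^[n] z) := by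
      unfold wprod
      rw [Finset.prod_range_succ]
    rw [e1, e2]
    linear_combination (v (φ (φ^[n] z)) * u (φ^[n] z)) * h2 + P.w1 _ h1

theorem Wf_swap {a b z : ℂ} (ha : ‖a‖ = 1) (hb : ‖b‖ = 1) (hab : a ≠ b) (hz : z ∈ D1) {s : ℝ}
    (hs : 0 < s) (hW : Wf a b z = (s : ℂ)) : ∃ t : ℝ, 0 < t ∧ Wf b a z = (t : ℂ) := by
  have h1 := sub_ne ha hz
  have h2 := sub_ne hb hz
  have hlt := re_lt_one ha hb hab
  set k : ℂ := (starRingEnd ℂ) a * b - 1 with hk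
  have hk0 : k ≠ 0 := by
    intro h
    have := congrArg Complex.re h
    simp only [hk, sub_re, one_re, zero_re] at this
    linarith
  have hs0 : (s : ℂ) ≠ 0 := by exact_mod_cast hs.ne'
  refine ⟨Complex.normSq k / s, div_pos (Complex.normSq_pos.2 hk0) hs, ?_⟩
  push_cast
  rw [eq_div_iff hs0, ← hW, ← Complex.mul_conj]
  have e : (starRingEnd ℂ) k = (starRingEnd ℂ) b * a - 1 := by
    rw [hk]; simp only [map_sub, map_mul, Complex.conj_conj, map_one]; ring
  unfold Wf
  rw [e, ← hk]
  field_simp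

theorem circle_sub {u φ v ψ : ℂ → ℂ} {a b : ℂ} {μ : ℝ} (H : Hyp φ a b μ) (H' : Hyp ψ b a μ)
    (hu : InDiscAlgebra u) (hv : InDiscAlgebra v) (P : InvPair u φ v ψ) {lam : ℂ} (hl : lam ≠ 0)
    (ha : ‖u a‖ = ‖lam‖) (hb : ‖u b‖ = ‖lam‖) (ha' : ‖v a‖ = ‖lam⁻¹‖) (hb' : ‖v b‖ = ‖lam⁻¹‖) :
    ¬ GoodInv (fun f z => lam * f z - wco u φ f z) := by
  intro hG
  obtain ⟨C, hC⟩ := lower H hu P.b1 hl ha hb hG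
  obtain ⟨C', hC'⟩ := lower H' hv P.b2 (inv_ne_zero hl) hb' ha' (transfer P hl hG)
  obtain ⟨z, hz, hW⟩ := Wf_surj H.ha H.hb H.hab
  obtain ⟨c, hc0, hc⟩ := H.low
  have hln : 0 < ‖lam‖ := norm_pos_iff.2 hl
  have hez := one_le_ell hz
  have hell : ∀ n : ℕ, ell (φ^[n] z) ≤ ell z + c * n := by
    intro n
    induction n with
    | zero => simp
    | succ n ih =>
      rw [Function.iterate_succ_apply']
      have := hc _ (H.iter_mem hz n)
      push_cast
      linarith
  set E : ℝ := |C'| * (ell z + c) with hE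
  have hE0 : 0 ≤ E := by positivity
  have key : ∀ k : ℕ, 1 / ((k : ℝ) + 1) ≤ E * (‖wprod u φ k z‖ / ‖lam‖ ^ k) := by
    intro k
    obtain ⟨hk1, hk2⟩ := wprod_inv P hz k
    obtain ⟨t, ht, hWt⟩ := Wf_swap H.ha H.hb H.hab hk1 (s := 1 * μ ^ k)
      (by have := H.pos; positivity) (H.iter_W hz hW k)
    have h1 := hC' _ hk1 t ht hWt (k + 1)
    have h2 : ‖wprod v ψ k (φ^[k] z)‖ / ‖lam⁻¹‖ ^ k ≤ C' * ell (φ^[k] z) := by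
      refine le_trans ?_ h1
      exact Finset.single_le_sum (f := fun n => ‖wprod v ψ n (φ^[k] z)‖ / ‖lam⁻¹‖ ^ n)
        (fun n _ => by positivity) (Finset.self_mem_range_succ k)
    have h3 := congrArg norm hk2
    rw [norm_mul, norm_one] at h3
    have hek := one_le_ell hk1
    have h4 : C' * ell (φ^[k] z) ≤ E * (k + 1) := by
      calc _ ≤ |C'| * ell (φ^[k] z) := mul_le_mul_of_nonneg_right (le_abs_self _) (by linarith)
        _ ≤ |C'| * ((ell z + c) * (k + 1)) := by
            gcongr
            refine (hell k).trans ?_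
            have : (0:ℝ) ≤ k := Nat.cast_nonneg k
            nlinarith
        _ = _ := by rw [hE]; ring
    rw [div_le_iff₀ (by positivity)]
    have h5 := h2.trans h4
    rw [norm_inv, inv_pow, div_inv_eq_mul] at h5
    have h6 : 0 ≤ ‖wprod u φ k z‖ / ‖lam‖ ^ k := by positivity
    have h7 := mul_le_mul_of_nonneg_right h5 h6
    have h8 : ‖wprod v ψ k (φ^[k] z)‖ * ‖lam‖ ^ k * (‖wprod u φ k z‖ / ‖lam‖ ^ k) = 1 := by
      rw [← h3]; field_simp
    rw [h8] at h7
    linarith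
  have hbd : ∀ N : ℕ, ∑ k ∈ Finset.range N, 1 / ((k : ℝ) + 1) ≤ E * (C * ell z) := by
    intro N
    refine (Finset.sum_le_sum fun k _ => key k).trans ?_
    rw [← Finset.mul_sum]
    exact mul_le_mul_of_nonneg_left (hC z hz 1 one_pos hW N) hE0
  obtain ⟨N, hN⟩ := (Real.tendsto_sum_range_one_div_nat_succ_atTop.eventually_gt_atTop
    (E * (C * ell z))).exists
  linarith [hbd N]

/-- hyperbolic case with |u(a)| = |u(b)|: the spectrum is a circle. -/
theorem stmt_17 (u φ : ℂ → ℂ) (a b : ℂ) (hu : InDiscAlgebra u)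
    (hh : IsHyperbolicAuto φ a b) (hinv : InvertibleOnBloch (wco u φ))
    (heq : ‖u a‖ = ‖u b‖) :
    blochSpectrum (wco u φ) = {lam : ℂ | ‖lam‖ = ‖u a‖} := by
  obtain ⟨μ, ψ, H, H', i1, i2, hψa, hψb, hψc, hψm⟩ := hyp_data hh
  have hG := hinv.goodInv
  obtain ⟨δ, hδ0, hδ⟩ := u_below H hu hG
  have hne : ∀ z ∈ closedBall (0:ℂ) 1, u z ≠ 0 := fun z hz =>
    norm_pos_iff.1 (hδ0.trans_le (hδ z hz))
  have hD : ∀ z ∈ D1, z ∈ closedBall (0:ℂ) 1 := fun z hz => ball_subset_closedBall hz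
  set v : ℂ → ℂ := fun z => (u (ψ z))⁻¹ with hv
  have hvA : InDiscAlgebra v := by
    constructor
    · exact (hu.1.comp hψc hψm).inv₀ (fun z hz => hne _ (hψm hz))
    · exact DifferentiableOn.fun_inv (DifferentiableOn.comp hu.2 H'.diff H'.maps)
        (fun z hz => hne _ (hψm (hD z hz)))
  have w1 : ∀ z ∈ D1, v (φ z) * u z = 1 := by
    intro z hz
    simp only [hv]
    rw [i1 z hz]
    exact inv_mul_cancel₀ (hne z (hD z hz))
  have w2 : ∀ z ∈ D1, u (ψ z) * v z = 1 := fun z hz =>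
    mul_inv_cancel₀ (hne _ (hψm (hD z hz)))
  have b2 : BddOnBloch (wco v ψ) := by
    obtain ⟨-, ⟨C1, hC0, hC⟩, hs⟩ := hG
    refine ⟨C1, fun f hf => ?_⟩
    obtain ⟨h, hh1, hh2⟩ := hs f hf
    have e : EqOn (wco v ψ f) h D1 := by
      intro w hw
      have h1 := hh2 (H'.maps w hw)
      simp only [wco] at h1 ⊢
      rw [i2 w hw] at h1
      rw [← h1]
      linear_combination (h w) * w2 w hw
    refine ⟨hh1.congr e, ?_⟩
    rw [blochNorm_congr e, ← blochNorm_congr hh2]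
    exact hC h hh1
  have P : InvPair u φ v ψ := ⟨H.maps, H'.maps, i1, i2, w1, w2, hG.1, b2⟩
  have hua : 0 < ‖u a‖ := norm_pos_iff.2 (hne a (by rw [mem_closedBall_zero_iff, H.ha]))
  have hva : ‖v a‖ = ‖u a‖⁻¹ := by simp only [hv]; rw [hψa, norm_inv]
  have hvb : ‖v b‖ = ‖u a‖⁻¹ := by simp only [hv]; rw [hψb, norm_inv, heq]
  ext lam
  simp only [blochSpectrum, Set.mem_ofPred_eq]
  rw [goodInv_iff]
  constructor
  · intro hn
    by_contra hcon
    apply hn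
    rcases lt_or_gt_of_ne hcon with h | h
    · by_cases h0 : lam = 0
      · rw [h0]; exact good_neg hG
      · have hlp : 0 < ‖lam‖ := norm_pos_iff.2 h0
        have h1 : ‖u a‖⁻¹ < ‖lam⁻¹‖ := by
          rw [norm_inv]; exact (inv_lt_inv₀ hua hlp).2 h
        have h2 := resolventB H' hvA b2 (lam := lam⁻¹) (by rw [hvb]; exact h1)
          (by rw [hva]; exact h1)
        have h3 := transfer P.symm (inv_ne_zero h0) h2
        rwa [inv_inv] at h3
    · exact resolventB H hu hG.1 h (by rw [← heq]; exact h)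
  · intro he
    have hl : lam ≠ 0 := norm_pos_iff.1 (by rw [he]; exact hua)
    refine circle_sub H H' hu hvA P hl he.symm (by rw [he, heq]) ?_ ?_
    · rw [hva, norm_inv, he]
    · rw [hvb, norm_inv, he]
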